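/- Let C be a subfield of ℝ that is ecl-closed (i.e. every real number exponentially algebraic over C belongs to C), and let p = (p₁,…,p_m) ∈ ℝ^m be exponentially algebraically independent over C (i.e. for each i, pᵢ is not exponentially algebraic over C ∪ {pⱼ : j ≠ i}). Then for every tuple z = (z₁,…,zₙ) ∈ ℝⁿ: td(exp(z₁),…,exp(zₙ) / C ∪ {p₁,…,p_m}) + ldim_{ℚ(p)}({z₁,…,zₙ}/∅) − ldim_ℚ({z₁,…,zₙ}/∅) ≥ 0, where ℚ(p) is the subfield of ℝ generated by p₁,…,p_m. (The kernel of exp on ℝ is {0}, so linear dimensions relative to the kernel reduce to absolute linear dimensions.) -/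

import Mathlib

/-- `x` is exponentially algebraic over `A ⊆ ℝ`: there are `n ≥ 1`, a tuple `xs` with
`xs 0 = x`, and `n` exponential polynomials (polynomials in variables `X₁,…,Xₙ,Y₁,…,Yₙ`,
with coefficients in the subring generated by `A ∪ ℤ`, where `Yⱼ` stands for `exp Xⱼ`)
vanishing at `(xs, exp xs)` with nonvanishing Jacobian determinant there; the `(i,j)`
Jacobian entry is the total derivative `∂fᵢ/∂Xⱼ + exp(xⱼ)·∂fᵢ/∂Yⱼ` at `(xs, exp xs)`. -/
def IsExpAlgebraicOver (A : Set ℝ) (x : ℝ) : Prop :=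
  ∃ (n : ℕ) (hn : 0 < n) (xs : Fin n → ℝ)
    (f : Fin n → MvPolynomial (Fin n ⊕ Fin n) ℝ),
    xs ⟨0, hn⟩ = x ∧
    (∀ i m, MvPolynomial.coeff m (f i) ∈ Subring.closure A) ∧
    (∀ i, MvPolynomial.eval (Sum.elim xs fun j => Real.exp (xs j)) (f i) = 0) ∧
    (Matrix.of fun i j =>
        MvPolynomial.eval (Sum.elim xs fun j => Real.exp (xs j))
          (MvPolynomial.pderiv (Sum.inl j) (f i)) +
        Real.exp (xs j) *
          MvPolynomial.eval (Sum.elim xs fun j => Real.exp (xs j))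
            (MvPolynomial.pderiv (Sum.inr j) (f i))).det ≠ 0

/-- `x` is exponentially algebraic (over `∅`, i.e. with integer coefficients). -/
def IsExpAlgebraic (x : ℝ) : Prop := IsExpAlgebraicOver ∅ x

/-- `td X Y` : the transcendence degree of the field `ℚ(X ∪ Y)` over `ℚ(Y)`,
realized as the supremum of the cardinalities of subsets of `ℚ(X ∪ Y)` that are
algebraically independent over `ℚ(Y)`. -/
noncomputable def td {F : Type*} [Field F] (X Y : Set F) : Cardinal :=
  ⨆ s : {s : Set F // s ⊆ ↑(Subfield.closure (X ∪ Y)) ∧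
      AlgebraicIndependent ↥(Subfield.closure Y) ((↑) : s → F)}, Cardinal.mk s.1

/-- `ldim K X Y` : the dimension of the `K`-vector space `span_K(X ∪ Y) / span_K(Y)`,
realized as the rank of the image of `span_K(X ∪ Y)` in `F / span_K(Y)`. -/
noncomputable def ldim (K : Type*) {F : Type*} [DivisionRing K] [AddCommGroup F]
    [Module K F] (X Y : Set F) : ℕ :=
  Module.finrank K
    (Submodule.map (Submodule.span K Y).mkQ (Submodule.span K (X ∪ Y)))

section derivationExtension

open KaehlerDifferential TensorProduct

theorem exists_derivation_extension {S F : Type*} [CommRing S] [Field F] [Algebra S F]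
    [Algebra.FormallySmooth S F] (d : Derivation ℤ S F) :
    ∃ D : Derivation ℤ F F, ∀ s, D (algebraMap S F s) = d s := by
  have hinj : Function.Injective (mapBaseChange ℤ S F) := by
    rw [injective_iff_map_eq_zero]
    intro x hx
    obtain ⟨y, rfl⟩ := (Algebra.H1Cotangent.exact_δ_mapBaseChange ℤ S F x).1 hx
    rw [Subsingleton.elim y 0, map_zero]
  obtain ⟨g, hg⟩ := LinearMap.exists_leftInverse_of_injective _ (LinearMap.ker_eq_bot.2 hinj)
  let ℓ : F ⊗[S] Ω[S⁄ℤ] →ₗ[F] F := d.liftKaehlerDifferential.liftBaseChange F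
  refine ⟨(ℓ ∘ₗ g).compDer (D ℤ F), fun s ↦ ?_⟩
  have h1 : D ℤ F (algebraMap S F s) = mapBaseChange ℤ S F (1 ⊗ₜ D ℤ S s) := by simp
  have h2 : g (D ℤ F (algebraMap S F s)) = 1 ⊗ₜ D ℤ S s := by
    rw [h1]; exact LinearMap.congr_fun hg _
  simp [h2, ℓ]

theorem formallySmooth_of_charZero (K F : Type*) [Field K] [Field F] [Algebra K F] [CharZero K] :
    Algebra.FormallySmooth K F := by
  obtain ⟨ι, v, hv⟩ := exists_isTranscendenceBasis' K F
  have := hv.isAlgebraic_field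
  exact .of_algebraicIndependent_of_isSeparable hv.1

theorem formallySmooth_of_injective (S F : Type*) [CommRing S] [Field F] [Algebra S F] [CharZero F]
    [FaithfulSMul S F] :
    Algebra.FormallySmooth S F := by
  have : IsDomain S := (FaithfulSMul.algebraMap_injective S F).isDomain
  have : CharZero S := (algebraMap S F).charZero
  let : Algebra (FractionRing S) F := FractionRing.liftAlgebra S F
  have := FractionRing.isScalarTower_liftAlgebra S F
  have : Algebra.FormallySmooth S (FractionRing S) := .of_isLocalization (nonZeroDivisors S)
  have : Algebra.FormallySmooth (FractionRing S) F := formallySmooth_of_charZero _ _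
  exact .comp _ (FractionRing S) _

theorem exists_derivation_of_ker {P F : Type*} [CommRing P] [Field F] [CharZero F] [Algebra P F]
    (d : Derivation ℤ P F) (hd : ∀ f, algebraMap P F f = 0 → d f = 0) :
    ∃ D : Derivation ℤ F F, ∀ f, D (algebraMap P F f) = d f := by
  let φ := algebraMap P F
  have hd' : ∀ f g, φ f = φ g → d f = d g := fun f g h ↦ by
    rw [← sub_eq_zero, ← map_sub]
    exact hd _ (by rw [map_sub]; exact sub_eq_zero.2 h)
  let r : φ.range → P := Function.surjInv φ.rangeRestrict_surjective
  have hr : ∀ s, φ (r s) = s := fun s ↦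
    congrArg Subtype.val (Function.surjInv_eq φ.rangeRestrict_surjective s)
  let d₀ : φ.range →+ F := AddMonoidHom.mk' (fun s ↦ d (r s)) fun a b ↦ by
    rw [← map_add]
    exact hd' _ _ (by simp [hr])
  have hleib : ∀ a b : φ.range, d₀ (a * b) = a • d₀ b + b • d₀ a := fun a b ↦ by
    have h : d (r (a * b)) = d (r a * r b) := hd' _ _ (by simp [hr])
    change d (r (a * b)) = (a : F) * d (r b) + (b : F) * d (r a)
    rw [h, Derivation.leibniz, Algebra.smul_def, Algebra.smul_def, hr, hr]
  have : Algebra.FormallySmooth φ.range F := formallySmooth_of_injective _ _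
  obtain ⟨D, hD⟩ := exists_derivation_extension (Derivation.mk' d₀.toIntLinearMap hleib)
  refine ⟨D, fun f ↦ ?_⟩
  exact (hD ⟨φ f, f, rfl⟩).trans (hd' _ _ (hr _))

theorem MvPolynomial.derivation_eq_sum_pderiv {σ R M : Type*} [Fintype σ] [CommRing R]
    [AddCommGroup M] [Module (MvPolynomial σ R) M]
    (d : Derivation ℤ (MvPolynomial σ R) M) (hd : ∀ r, d (C r) = 0) (f : MvPolynomial σ R) :
    d f = ∑ i, pderiv i f • d (X i) := by
  classical
  induction f using MvPolynomial.induction_on with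
  | C r => simp [hd]
  | add p q hp hq => simp [hp, hq, add_smul, Finset.sum_add_distrib]
  | mul_X p i hp =>
    simp only [Derivation.leibniz, hp, smul_eq_mul, pderiv_X, add_smul, Finset.sum_add_distrib,
      Finset.smul_sum, mul_smul]
    congr 1
    rw [Finset.sum_eq_single i]
    · simp
    · intro j _ hj
      simp [hj.symm]
    · simp

theorem Derivation.map_aeval_eq_sum {σ R F : Type*} [Fintype σ] [CommRing R] [CommRing F]
    [Algebra R F] (D : Derivation ℤ F F) (hD : ∀ r : R, D (algebraMap R F r) = 0) (a : σ → F)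
    (f : MvPolynomial σ R) :
    D (MvPolynomial.aeval a f) =
      ∑ i, MvPolynomial.aeval a (MvPolynomial.pderiv i f) * D (a i) := by
  let : Algebra (MvPolynomial σ R) F := (MvPolynomial.aeval a).toRingHom.toAlgebra
  have h := MvPolynomial.derivation_eq_sum_pderiv (D.compAlgebraMap (MvPolynomial σ R))
    (fun r ↦ by
      change D (MvPolynomial.aeval a (MvPolynomial.C r)) = 0
      simpa using hD r) f
  refine h.trans (Finset.sum_congr rfl fun i _ ↦ ?_)
  rw [Algebra.smul_def]
  change MvPolynomial.aeval a (MvPolynomial.pderiv i f) *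
    D (MvPolynomial.aeval a (MvPolynomial.X i)) = _
  simp

/-- A tuple of `σ`-indexed tangent values which annihilates all polynomial relations between the
`a i` over `R` comes from a derivation. -/
theorem exists_derivation_of_tangent {σ R F : Type*} [Fintype σ] [CommRing R] [Field F] [CharZero F]
    [Algebra R F] (a v : σ → F)
    (hv : ∀ f : MvPolynomial σ R, MvPolynomial.aeval a f = 0 →
      ∑ i, MvPolynomial.aeval a (MvPolynomial.pderiv i f) * v i = 0) :
    ∃ D : Derivation ℤ F F, (∀ r : R, D (algebraMap R F r) = 0) ∧ ∀ i, D (a i) = v i := by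
  let : Algebra (MvPolynomial σ R) F := (MvPolynomial.aeval a).toRingHom.toAlgebra
  have : IsScalarTower R (MvPolynomial σ R) F := .of_algebraMap_eq fun r ↦ by
    change _ = MvPolynomial.aeval a (MvPolynomial.C r)
    simp
  let d : Derivation ℤ (MvPolynomial σ R) F := (MvPolynomial.mkDerivation R v).restrictScalars ℤ
  have hdC : ∀ r, d (MvPolynomial.C r) = 0 := MvPolynomial.mkDerivationₗ_C v
  have hdX : ∀ i, d (MvPolynomial.X i) = v i := MvPolynomial.mkDerivation_X R v
  have hd : ∀ f, d f = ∑ i, MvPolynomial.aeval a (MvPolynomial.pderiv i f) * v i := fun f ↦ by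
    refine (MvPolynomial.derivation_eq_sum_pderiv d hdC f).trans ?_
    simp only [Algebra.smul_def, hdX]
    rfl
  obtain ⟨D, hD⟩ := exists_derivation_of_ker d fun f hf ↦ (hd f).trans (hv f hf)
  refine ⟨D, fun r ↦ ?_, fun i ↦ ?_⟩
  · rw [IsScalarTower.algebraMap_apply R (MvPolynomial σ R) F, hD]
    exact hdC r
  · have := hD (MvPolynomial.X i)
    rw [show algebraMap (MvPolynomial σ R) F (MvPolynomial.X i) = a i from
      MvPolynomial.aeval_X a i] at this
    exact this.trans (hdX i)

theorem exists_derivation_eq_one_of_transcendental {K F : Type*} [Field K] [Field F] [CharZero F]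
    [Algebra K F] {t : F} (ht : Transcendental K t) :
    ∃ D : Derivation ℤ F F, (∀ r : K, D (algebraMap K F r) = 0) ∧ D t = 1 := by
  have hindep : AlgebraicIndependent K fun _ : Unit ↦ t := algebraicIndependent_unique_type_iff.2 ht
  obtain ⟨D, hD, hDt⟩ := exists_derivation_of_tangent (R := K) (fun _ : Unit ↦ t) 1 fun f hf ↦ by
    rw [hindep.eq_zero_of_aeval_eq_zero f hf]
    simp
  exact ⟨D, hD, hDt ()⟩

end derivationExtension

/-- The derivations of `F` that vanish on `S`. -/
def derivationsOver {F : Type*} [Field F] (S : Set F) : Submodule F (Derivation ℤ F F) where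
  carrier := {D | ∀ s ∈ S, D s = 0}
  add_mem' {D E} hD hE s hs := by simp [hD s hs, hE s hs]
  zero_mem' s _ := rfl
  smul_mem' c D hD s hs := by simp [hD s hs]

section derivationsOver

variable {F : Type*} [Field F]

theorem mem_derivationsOver {S : Set F} {D : Derivation ℤ F F} :
    D ∈ derivationsOver S ↔ ∀ s ∈ S, D s = 0 := Iff.rfl

theorem derivationsOver_anti {S T : Set F} (h : S ⊆ T) : derivationsOver T ≤ derivationsOver S :=
  fun _ hD s hs ↦ hD s (h hs)

theorem derivationsOver_union (S T : Set F) :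
    derivationsOver (S ∪ T) = derivationsOver S ⊓ derivationsOver T := by
  ext D
  simp [mem_derivationsOver, or_imp, forall_and]

/-- The field of constants of a derivation. -/
def Derivation.constants (D : Derivation ℤ F F) : Subfield F where
  carrier := {x | D x = 0}
  mul_mem' {x y} hx hy := by simp_all
  one_mem' := by simp
  add_mem' {x y} hx hy := by simp_all
  zero_mem' := by simp
  neg_mem' {x} hx := by simp_all
  inv_mem' x hx := by
    change D x = 0 at hx
    change D x⁻¹ = 0
    rw [Derivation.leibniz_inv, hx, smul_zero]

theorem Derivation.mem_constants {D : Derivation ℤ F F} {x : F} : x ∈ D.constants ↔ D x = 0 :=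
  Iff.rfl

theorem Derivation.map_polynomial_aeval {K F M : Type*} [Field K] [Field F] [Algebra K F]
    [AddCommGroup M] [Module F M] (D : Derivation ℤ F M)
    (hD : ∀ r : K, D (algebraMap K F r) = 0) (x : F) (f : Polynomial K) :
    D (Polynomial.aeval x f) = Polynomial.aeval x (Polynomial.derivative f) • D x := by
  induction f using Polynomial.induction_on' with
  | add p q hp hq => simp [hp, hq, add_smul]
  | monomial n a =>
    simp [Polynomial.aeval_monomial, Polynomial.derivative_monomial, hD, Derivation.leibniz_pow,
      mul_smul, Nat.cast_smul_eq_nsmul]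

theorem Derivation.map_eq_zero_of_isAlgebraic {K F M : Type*} [Field K] [Field F] [CharZero F]
    [Algebra K F] [AddCommGroup M] [Module F M]
    {D : Derivation ℤ F M} (hD : ∀ r : K, D (algebraMap K F r) = 0) {x : F}
    (hx : IsAlgebraic K x) : D x = 0 := by
  have : CharZero K := (algebraMap K F).charZero
  have hmin := D.map_polynomial_aeval hD x (minpoly K x)
  rw [minpoly.aeval, map_zero] at hmin
  refine (smul_eq_zero.1 hmin.symm).resolve_left ?_
  exact (minpoly.irreducible hx.isIntegral).separable.aeval_derivative_ne_zero (minpoly.aeval K x)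

end derivationsOver

/-- Any derivation over `A` which respects the exponential on `s` vanishes on `s`. -/
def ExpRigid (A s : Set ℝ) : Prop :=
  ∀ D ∈ derivationsOver A, (∀ t ∈ s, D (Real.exp t) = Real.exp t * D t) → ∀ t ∈ s, D t = 0

theorem exists_det_ne_zero_of_span_eq_top {K : Type*} [Field K] {n : ℕ} {G : Set (Fin n → K)}
    (hG : Submodule.span K G = ⊤) :
    ∃ g : Fin n → Fin n → K, (∀ i, g i ∈ G) ∧ (Matrix.of g).det ≠ 0 := by
  obtain ⟨b, hbG, hb, hli⟩ := exists_linearIndependent K G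
  let B := Module.Basis.mk hli (by simp [hb, hG])
  let e : Fin n ≃ b := (Pi.basisFun K (Fin n)).indexEquiv B
  refine ⟨fun i ↦ e i, fun i ↦ hbG (e i).2, ?_⟩
  rw [← isUnit_iff_ne_zero, ← Matrix.isUnit_iff_isUnit_det,
    ← Matrix.linearIndependent_rows_iff_isUnit]
  exact hli.comp e e.injective

theorem ExpRigid.exists_system {A : Set ℝ} {n : ℕ} {xs : Fin n → ℝ}
    (h : ExpRigid A (Set.range xs)) :
    ∃ f : Fin n → MvPolynomial (Fin n ⊕ Fin n) (Subring.closure A),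
      (∀ i, MvPolynomial.aeval (Sum.elim xs fun j ↦ Real.exp (xs j)) (f i) = 0) ∧
      (Matrix.of fun i j ↦
        MvPolynomial.aeval (Sum.elim xs fun j ↦ Real.exp (xs j))
          (MvPolynomial.pderiv (Sum.inl j) (f i)) +
        Real.exp (xs j) * MvPolynomial.aeval (Sum.elim xs fun j ↦ Real.exp (xs j))
            (MvPolynomial.pderiv (Sum.inr j) (f i))).det ≠ 0 := by
  set a : Fin n ⊕ Fin n → ℝ := Sum.elim xs fun j ↦ Real.exp (xs j) with ha
  let grad (f : MvPolynomial (Fin n ⊕ Fin n) (Subring.closure A)) (j : Fin n) : ℝ :=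
    MvPolynomial.aeval a (MvPolynomial.pderiv (Sum.inl j) f) +
      Real.exp (xs j) * MvPolynomial.aeval a (MvPolynomial.pderiv (Sum.inr j) f)
  suffices hspan : Submodule.span ℝ (grad '' {f | MvPolynomial.aeval a f = 0}) = ⊤ by
    obtain ⟨g, hg, hdet⟩ := exists_det_ne_zero_of_span_eq_top hspan
    choose f hf hfg using hg
    refine ⟨f, hf, ?_⟩
    have : g = fun i ↦ grad (f i) := funext fun i ↦ (hfg i).symm
    rwa [this] at hdet
  by_contra hne
  obtain ⟨ℓ, hℓ0, hℓ⟩ := Submodule.exists_le_ker_of_lt_top _ (lt_top_iff_ne_top.2 hne)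
  let v (j : Fin n) : ℝ := ℓ (Pi.single j 1)
  have hℓv (w : Fin n → ℝ) : ℓ w = ∑ j, w j * v j := by
    rw [LinearMap.pi_apply_eq_sum_univ ℓ w]
    simp only [smul_eq_mul, v]
    congr! with j _ k
    simp [Pi.single_apply, eq_comm]
  obtain ⟨D, hDA, hD⟩ := exists_derivation_of_tangent (R := Subring.closure A) a
    (Sum.elim v fun j ↦ Real.exp (xs j) * v j) fun f hf ↦ by
      have := hℓ (Submodule.subset_span ⟨f, hf, rfl⟩)
      rw [LinearMap.mem_ker, hℓv] at this
      rw [← this, Fintype.sum_sum_type, ← Finset.sum_add_distrib]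
      refine Finset.sum_congr rfl fun j _ ↦ ?_
      simp only [Sum.elim_inl, Sum.elim_inr, grad]
      ring
  have hDx (j : Fin n) : D (xs j) = v j := hD (Sum.inl j)
  have hDe (j : Fin n) : D (Real.exp (xs j)) = Real.exp (xs j) * v j := hD (Sum.inr j)
  have hv := h D (fun s hs ↦ hDA ⟨s, Subring.subset_closure hs⟩)
    (by rintro _ ⟨j, rfl⟩; rw [hDe, hDx])
  refine hℓ0 (LinearMap.ext fun w ↦ ?_)
  rw [hℓv]
  simp [← hDx, hv _ ⟨_, rfl⟩]

theorem ExpRigid.exists_real_system {A : Set ℝ} {n : ℕ} {xs : Fin n → ℝ}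
    (h : ExpRigid A (Set.range xs)) :
    ∃ f : Fin n → MvPolynomial (Fin n ⊕ Fin n) ℝ,
      (∀ i m, MvPolynomial.coeff m (f i) ∈ Subring.closure A) ∧
      (∀ i, MvPolynomial.eval (Sum.elim xs fun j ↦ Real.exp (xs j)) (f i) = 0) ∧
      (Matrix.of fun i j ↦
        MvPolynomial.eval (Sum.elim xs fun j ↦ Real.exp (xs j))
          (MvPolynomial.pderiv (Sum.inl j) (f i)) +
        Real.exp (xs j) * MvPolynomial.eval (Sum.elim xs fun j ↦ Real.exp (xs j))
            (MvPolynomial.pderiv (Sum.inr j) (f i))).det ≠ 0 := by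
  obtain ⟨f, hf, hdet⟩ := h.exists_system
  refine ⟨fun i ↦ MvPolynomial.map (algebraMap (Subring.closure A) ℝ) (f i), fun i m ↦ ?_,
    fun i ↦ ?_, ?_⟩
  · rw [MvPolynomial.coeff_map]
    exact (MvPolynomial.coeff m (f i)).2
  · rw [MvPolynomial.eval_map]
    exact hf i
  · simp only [MvPolynomial.pderiv_map, MvPolynomial.eval_map]
    exact hdet

theorem Derivation.map_eval_eq_sum {σ F : Type*} [Fintype σ] [Field F] {D : Derivation ℤ F F}
    {f : MvPolynomial σ F} (hf : ∀ m, D (MvPolynomial.coeff m f) = 0) (a : σ → F) :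
    D (MvPolynomial.eval a f) =
      ∑ i, MvPolynomial.eval a (MvPolynomial.pderiv i f) * D (a i) := by
  have : f ∈ Set.range (MvPolynomial.map D.constants.subtype) := by
    rw [MvPolynomial.mem_range_map_iff_coeffs_subset]
    intro c hc
    obtain ⟨m, -, rfl⟩ := MvPolynomial.mem_coeffs_iff.1 hc
    exact ⟨⟨_, hf m⟩, rfl⟩
  obtain ⟨g, rfl⟩ := this
  simp only [MvPolynomial.pderiv_map, MvPolynomial.eval_map]
  exact D.map_aeval_eq_sum (R := D.constants) (fun r ↦ r.2) a g

theorem Derivation.eq_zero_of_exp_system {n : ℕ} {xs : Fin n → ℝ}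
    {f : Fin n → MvPolynomial (Fin n ⊕ Fin n) ℝ}
    (hf : ∀ i, MvPolynomial.eval (Sum.elim xs fun j ↦ Real.exp (xs j)) (f i) = 0)
    (hdet : (Matrix.of fun i j ↦
        MvPolynomial.eval (Sum.elim xs fun j ↦ Real.exp (xs j))
          (MvPolynomial.pderiv (Sum.inl j) (f i)) +
        Real.exp (xs j) * MvPolynomial.eval (Sum.elim xs fun j ↦ Real.exp (xs j))
            (MvPolynomial.pderiv (Sum.inr j) (f i))).det ≠ 0) {D : Derivation ℤ ℝ ℝ}
    (hD : ∀ i m, D (MvPolynomial.coeff m (f i)) = 0)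
    (hexp : ∀ j, D (Real.exp (xs j)) = Real.exp (xs j) * D (xs j)) (j : Fin n) :
    D (xs j) = 0 := by
  refine congrFun (Matrix.eq_zero_of_mulVec_eq_zero hdet (v := fun j ↦ D (xs j)) ?_) j
  ext i
  have := D.map_eval_eq_sum (hD i) (Sum.elim xs fun j ↦ Real.exp (xs j))
  rw [hf, map_zero, Fintype.sum_sum_type, ← Finset.sum_add_distrib] at this
  rw [Matrix.mulVec_eq_sum, Finset.sum_apply]
  refine Eq.trans (Finset.sum_congr rfl fun k _ ↦ ?_) this.symm
  simp only [Pi.smul_apply, MulOpposite.smul_eq_mul_unop, MulOpposite.unop_op,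
    Matrix.transpose_apply, Matrix.of_apply, Sum.elim_inl, Sum.elim_inr, hexp]
  ring

theorem ExpRigid.union {A s t : Set ℝ} (hs : ExpRigid A s) (ht : ExpRigid A t) :
    ExpRigid A (s ∪ t) := fun D hD hexp x hx ↦
  hx.elim (hs D hD (fun y hy ↦ hexp y (Or.inl hy)) x) (ht D hD (fun y hy ↦ hexp y (Or.inr hy)) x)

/-- `x` belongs to a finite set which is rigid over `A`. -/
def MemExpClosure (A : Set ℝ) (x : ℝ) : Prop :=
  ∃ s : Set ℝ, s.Finite ∧ x ∈ s ∧ ExpRigid A s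

theorem exists_finite_expRigid_superset {A s : Set ℝ} (hs : s.Finite)
    (h : ∀ x ∈ s, MemExpClosure A x) : ∃ t : Set ℝ, t.Finite ∧ s ⊆ t ∧ ExpRigid A t := by
  induction s, hs using Set.Finite.induction_on with
  | empty => exact ⟨∅, Set.finite_empty, subset_rfl, fun _ _ _ _ h ↦ h.elim⟩
  | insert _ _ ih =>
    obtain ⟨t, ht, hst, hr⟩ := ih fun x hx ↦ h x (Or.inr hx)
    obtain ⟨u, hu, hau, hr'⟩ := h _ (Or.inl rfl)
    exact ⟨u ∪ t, hu.union ht,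
      Set.insert_subset (Or.inl hau) (hst.trans Set.subset_union_right), hr'.union hr⟩

theorem MemExpClosure.of_finite {A s : Set ℝ} (hs : s.Finite) (h : ∀ x ∈ s, MemExpClosure A x)
    {y : ℝ} (hy : ∀ D ∈ derivationsOver A, (∀ t ∈ s, D t = 0) → (∀ t ∈ s, D (Real.exp t) = 0) →
      D y = 0) : MemExpClosure A y := by
  obtain ⟨t, ht, hst, hr⟩ := exists_finite_expRigid_superset hs h
  refine ⟨insert y t, ht.insert y, Or.inl rfl, fun D hD hexp x hx ↦ ?_⟩
  have hexp' : ∀ u ∈ t, D (Real.exp u) = Real.exp u * D u := fun u hu ↦ hexp u (Or.inr hu)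
  have h0 := hr D hD hexp'
  rcases hx with rfl | hx
  · exact hy D hD (fun u hu ↦ h0 u (hst hu)) fun u hu ↦ by
      rw [hexp' u (hst hu), h0 u (hst hu), mul_zero]
  · exact h0 x hx

/-- The exponential algebraic closure of `A`, as a subfield of `ℝ`. -/
def expClosure (A : Set ℝ) : Subfield ℝ where
  carrier := {x | MemExpClosure A x}
  mul_mem' {x y} hx hy := .of_finite (Set.toFinite {x, y}) (by simp_all) (by simp +contextual)
  one_mem' := .of_finite Set.finite_empty (by simp) (by simp)
  add_mem' {x y} hx hy := .of_finite (Set.toFinite {x, y}) (by simp_all) (by simp +contextual)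
  zero_mem' := .of_finite Set.finite_empty (by simp) (by simp)
  neg_mem' {x} hx := .of_finite (Set.toFinite {x}) (by simpa) (by simp +contextual)
  inv_mem' x hx := .of_finite (Set.toFinite {x}) (by simpa)
    (by simp +contextual [Derivation.leibniz_inv])

theorem subset_expClosure (A : Set ℝ) : A ⊆ expClosure A := fun x hx ↦
  MemExpClosure.of_finite Set.finite_empty (by simp) fun _ hD _ _ ↦ hD x hx

theorem ExpRigid.mono {A B s : Set ℝ} (h : A ⊆ B) (hs : ExpRigid A s) : ExpRigid B s :=
  fun D hD ↦ hs D (derivationsOver_anti h hD)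

theorem expClosure_mono {A B : Set ℝ} (h : A ⊆ B) : expClosure A ≤ expClosure B := by
  rintro x ⟨s, hs, hx, hr⟩
  exact ⟨s, hs, hx, hr.mono h⟩

theorem exp_mem_expClosure {A : Set ℝ} {x : ℝ} (hx : x ∈ expClosure A) :
    Real.exp x ∈ expClosure A :=
  MemExpClosure.of_finite (Set.finite_singleton x) (by simpa) (by simp)

theorem mem_expClosure_of_isAlgebraic {A : Set ℝ} {x : ℝ} (hx : IsAlgebraic (expClosure A) x) :
    x ∈ expClosure A := by
  obtain ⟨f, hf0, hf⟩ := hx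
  let c : Set ℝ := (fun i ↦ (f.coeff i : ℝ)) '' (f.support : Set ℕ)
  refine MemExpClosure.of_finite (s := c) (f.support.finite_toSet.image _) ?_ fun D _ hc _ ↦ ?_
  · rintro _ ⟨i, -, rfl⟩
    exact (f.coeff i).2
  have hmem : f.map (expClosure A).subtype ∈ Polynomial.lifts D.constants.subtype := by
    rw [Polynomial.lifts_iff_coeff_lifts]
    intro i
    refine ⟨⟨(f.coeff i : ℝ), ?_⟩, by simp⟩
    by_cases hi : i ∈ f.support
    · exact hc _ ⟨i, hi, rfl⟩
    · rw [Polynomial.notMem_support_iff.1 hi]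
      exact D.constants.zero_mem
  obtain ⟨g, hg⟩ := (Polynomial.mem_lifts _).1 hmem
  refine Derivation.map_eq_zero_of_isAlgebraic (K := D.constants) (fun r ↦ r.2) ⟨g, ?_, ?_⟩
  · rintro rfl
    rw [Polynomial.map_zero] at hg
    exact hf0 ((Polynomial.map_eq_zero _).1 hg.symm)
  · rw [Polynomial.aeval_def, ← Polynomial.eval_map]
    change Polynomial.eval x (g.map D.constants.subtype) = 0
    rw [hg, Polynomial.eval_map]
    exact hf

theorem isExpAlgebraicOver_of_mem_expClosure {A : Set ℝ} {x : ℝ} (hx : x ∈ expClosure A) :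
    IsExpAlgebraicOver A x := by
  obtain ⟨s, hs, hxs, hr⟩ := hx
  obtain ⟨n, e, -, rfl⟩ := hs.fin_param
  obtain ⟨k, rfl⟩ := hxs
  have hn : 0 < n := k.pos
  let xs : Fin n → ℝ := e ∘ Equiv.swap k ⟨0, hn⟩
  have hrange : Set.range xs = Set.range e := EquivLike.range_comp e (Equiv.swap k ⟨0, hn⟩)
  rw [← hrange] at hr
  obtain ⟨f, hf⟩ := hr.exists_real_system
  exact ⟨n, hn, xs, f, by simp [xs], hf⟩

theorem subset_expClosure_of_expRigid {A s : Set ℝ} (hs : s.Finite)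
    (hr : ExpRigid (expClosure A) s) : s ⊆ expClosure A := by
  obtain ⟨n, xs, -, rfl⟩ := hs.fin_param
  obtain ⟨f, hf, hf0, hdet⟩ := hr.exists_real_system
  have hcl : Subring.closure (expClosure A : Set ℝ) = (expClosure A).toSubring :=
    Subring.closure_eq (expClosure A).toSubring
  let c : Set ℝ := ⋃ i, (f i).coeffs
  have hc : c.Finite := Set.finite_iUnion fun i ↦ (f i).coeffs.finite_toSet
  obtain ⟨t, ht, hct, htr⟩ := exists_finite_expRigid_superset (A := A) hc <| by
    simp only [c, Set.mem_iUnion, Finset.mem_coe, MvPolynomial.mem_coeffs_iff]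
    rintro _ ⟨i, m, -, rfl⟩
    have := hf i m
    rwa [hcl] at this
  intro x hx
  refine ⟨t ∪ Set.range xs, ht.union (Set.finite_range xs), Or.inr hx, fun D hD hexp ↦ ?_⟩
  have ht0 := htr D hD fun u hu ↦ hexp u (Or.inl hu)
  rintro y (hy | ⟨j, rfl⟩)
  · exact ht0 y hy
  refine Derivation.eq_zero_of_exp_system hf0 hdet (fun i m ↦ ?_)
    (fun j ↦ hexp _ (Or.inr ⟨j, rfl⟩)) j
  by_cases hm : m ∈ (f i).support
  · exact ht0 _ (hct (Set.mem_iUnion.2 ⟨i, MvPolynomial.mem_coeffs_iff.2 ⟨m, hm, rfl⟩⟩))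
  · rw [MvPolynomial.notMem_support_iff.1 hm, map_zero]

namespace Submodule

variable {R M N : Type*} [Ring R] [AddCommGroup M] [Module R M] [AddCommGroup N] [Module R N]

/-- The length of `P` modulo `Q`. -/
noncomputable def relLength (P Q : Submodule R M) : ℕ∞ := Module.length R (P.map Q.mkQ)

theorem relLength_ker (P : Submodule R M) (f : M →ₗ[R] N) :
    P.relLength (LinearMap.ker f) = Module.length R (P.map f) := by
  let g : (M ⧸ LinearMap.ker f) →ₗ[R] N := (LinearMap.ker f).liftQ f le_rfl
  have hg : Function.Injective g := by
    rw [← LinearMap.ker_eq_bot]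
    exact ker_liftQ_eq_bot _ _ _ le_rfl
  have : (P.map (LinearMap.ker f).mkQ).map g = P.map f := by
    rw [← Submodule.map_comp, liftQ_mkQ]
  rw [relLength, ← this]
  exact (Submodule.equivMapOfInjective g hg _).length_eq

theorem relLength_sup_right (P Q : Submodule R M) : (P ⊔ Q).relLength Q = P.relLength Q := by
  rw [relLength, Submodule.map_sup, mkQ_map_self, sup_bot_eq, relLength]

theorem relLength_inf_left (P Q : Submodule R M) : P.relLength (P ⊓ Q) = P.relLength Q := by
  have key (Q : Submodule R M) : P.relLength Q = Module.length R (P ⧸ Q.comap P.subtype) := by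
    have h := (LinearMap.quotKerEquivRange (Q.mkQ ∘ₗ P.subtype)).length_eq
    rw [LinearMap.ker_comp, ker_mkQ, LinearMap.range_comp, range_subtype] at h
    exact h.symm
  rw [key, key, Submodule.comap_inf, Submodule.comap_subtype_self, top_inf_eq]

theorem relLength_add_of_le {P Q T : Submodule R M} (h₁ : T ≤ Q) (h₂ : Q ≤ P) :
    P.relLength T = Q.relLength T + P.relLength Q := by
  let f : Q.map T.mkQ →ₗ[R] P.map T.mkQ := Submodule.inclusion (Submodule.map_mono h₂)
  let g : P.map T.mkQ →ₗ[R] P.map Q.mkQ := (Submodule.factor h₁).restrict (by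
    rintro _ ⟨x, hx, rfl⟩
    exact ⟨x, hx, rfl⟩)
  refine Module.length_eq_add_of_exact f g (Submodule.inclusion_injective _) ?_ ?_
  · rintro ⟨_, x, hx, rfl⟩
    exact ⟨⟨_, x, hx, rfl⟩, rfl⟩
  · rintro ⟨_, x, hx, rfl⟩
    have : g ⟨T.mkQ x, x, hx, rfl⟩ = 0 ↔ x ∈ Q := by
      rw [Subtype.ext_iff]
      exact Submodule.Quotient.mk_eq_zero Q
    rw [this]
    constructor
    · exact fun h ↦ ⟨⟨_, x, h, rfl⟩, rfl⟩
    · rintro ⟨⟨_, y, hy, rfl⟩, h⟩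
      have h' : T.mkQ y = T.mkQ x := congrArg Subtype.val h
      rw [← sub_eq_zero, ← map_sub] at h'
      have := h₁ ((Submodule.Quotient.mk_eq_zero T).1 h')
      exact (Submodule.sub_mem_iff_right Q hy).1 this

theorem relLength_sup (P Q T : Submodule R M) :
    (P ⊔ Q).relLength T = Q.relLength T + P.relLength (Q ⊔ T) := by
  rw [← relLength_sup_right, relLength_add_of_le (Q := Q ⊔ T) le_sup_right
    (sup_le_sup_right le_sup_right _), relLength_sup_right, sup_assoc, relLength_sup_right]

theorem relLength_inf (P Q T : Submodule R M) :
    P.relLength (Q ⊓ T) = P.relLength Q + (P ⊓ Q).relLength T := by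
  rw [← relLength_inf_left, relLength_add_of_le (Q := P ⊓ Q) (inf_le_inf_left _ inf_le_left)
    inf_le_left, relLength_inf_left, ← inf_assoc, relLength_inf_left, add_comm]

theorem relLength_mono_left {P P' : Submodule R M} (h : P ≤ P') (Q : Submodule R M) :
    P.relLength Q ≤ P'.relLength Q :=
  Module.length_le_of_injective _ (Submodule.inclusion_injective (Submodule.map_mono h))

theorem relLength_anti_right (P : Submodule R M) {Q Q' : Submodule R M} (h : Q ≤ Q') :
    P.relLength Q' ≤ P.relLength Q := by
  rw [← inf_eq_right.2 h, relLength_inf]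
  exact le_self_add

theorem one_le_relLength {P Q : Submodule R M} (h : ¬ P ≤ Q) : 1 ≤ P.relLength Q := by
  rw [Order.one_le_iff_ne_zero, relLength, Ne, Module.length_eq_zero_iff]
  intro hs
  refine h fun x hx ↦ (Submodule.Quotient.mk_eq_zero Q).1 ?_
  exact congrArg Subtype.val (Subsingleton.elim (⟨_, x, hx, rfl⟩ : P.map Q.mkQ) 0)

theorem relLength_eq_zero {P Q : Submodule R M} (h : P ≤ Q) : P.relLength Q = 0 := by
  rw [relLength, Module.length_eq_zero_iff, Submodule.subsingleton_iff_eq_bot,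
    ← le_bot_iff, Submodule.map_le_iff_le_comap]
  intro x hx
  exact (Submodule.Quotient.mk_eq_zero Q).2 (h hx)

theorem relLength_bot (P : Submodule R M) : P.relLength ⊥ = Module.length R P := by
  rw [← LinearMap.ker_id (R := R) (M := M), relLength_ker, Submodule.map_id]

end Submodule

section DivisionRing

variable {K M : Type*} [DivisionRing K] [AddCommGroup M] [Module K M]

theorem Submodule.relLength_le_card {ι : Type*} [Fintype ι] {P Q : Submodule K M}
    (φ : M →ₗ[K] (ι → K)) (h : P ⊓ LinearMap.ker φ ≤ Q) : P.relLength Q ≤ Fintype.card ι := by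
  refine (relLength_anti_right P h).trans ?_
  rw [relLength_inf_left, relLength_ker]
  refine (Module.length_le_of_injective _ (Submodule.subtype_injective _)).trans ?_
  rw [Module.length_eq_finrank, Module.finrank_fintype_fun_eq_card]

theorem Submodule.relLength_ker_of_map_eq_top {ι : Type*} [Fintype ι] {P : Submodule K M}
    (φ : M →ₗ[K] (ι → K)) (h : P.map φ = ⊤) :
    P.relLength (LinearMap.ker φ) = Fintype.card ι := by
  rw [relLength_ker, h, Module.length_top, Module.length_eq_finrank,
    Module.finrank_fintype_fun_eq_card]

theorem Submodule.exists_basis_mod (P Q : Submodule K M) [FiniteDimensional K P] :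
    ∃ (a : ℕ) (t : Fin a → M), (a : ℕ∞) = P.relLength Q ∧ (∀ i, t i ∈ P) ∧
      LinearIndependent K (Q.mkQ ∘ t) ∧ P ≤ span K (Set.range t) ⊔ Q := by
  let b := Module.finBasis K (P.map Q.mkQ)
  have hlift (i : Fin (Module.finrank K (P.map Q.mkQ))) : ∃ x ∈ P, Q.mkQ x = b i := (b i).2
  choose t ht htb using hlift
  refine ⟨_, t, ?_, ht, ?_, ?_⟩
  · rw [relLength, Module.length_eq_finrank]
  · have : Q.mkQ ∘ t = (P.map Q.mkQ).subtype ∘ b := funext htb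
    rw [this]
    exact b.linearIndependent.map' _ (ker_subtype _)
  · have h1 : (span K (Set.range t)).map Q.mkQ = P.map Q.mkQ := by
      have : Q.mkQ ∘ t = (P.map Q.mkQ).subtype ∘ b := funext htb
      rw [Submodule.map_span, ← Set.range_comp, this, Set.range_comp, ← Submodule.map_span,
        b.span_eq, Submodule.map_subtype_top]
    rw [sup_comm, ← Submodule.comap_map_mkQ, h1]
    exact Submodule.le_comap_map _ _

end DivisionRing

theorem AlgHom.map_derivation_of_isAlgebraic {k F Ω : Type*} [Field k] [Field F] [Field Ω]
    [CharZero F] [Algebra k F] [Algebra k Ω] [Algebra.IsAlgebraic k F] (σ : F →ₐ[k] Ω)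
    (D : Derivation ℤ F F) (E : Derivation ℤ Ω Ω)
    (h : ∀ r : k, σ (D (algebraMap k F r)) = E (algebraMap k Ω r)) (y : F) :
    σ (D y) = E (σ y) := by
  let : Algebra F Ω := σ.toRingHom.toAlgebra
  have hsm (a : F) (b : Ω) : a • b = σ a * b := rfl
  let d : Derivation ℤ F Ω := Derivation.mk'
    (((σ : F →+ Ω).comp (D : F →+ F)).toIntLinearMap -
      ((E : Ω →+ Ω).comp (σ : F →+ Ω)).toIntLinearMap) fun a b ↦ by
    simp only [hsm, LinearMap.sub_apply, AddMonoidHom.coe_toIntLinearMap, AddMonoidHom.comp_apply,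
      AddMonoidHom.coe_coe, Derivation.leibniz, smul_eq_mul, map_add, map_mul]
    ring
  have hd (a : F) : d a = σ (D a) - E (σ a) := rfl
  have : d y = 0 := Derivation.map_eq_zero_of_isAlgebraic (K := k)
    (fun r ↦ by rw [hd, h, σ.commutes, sub_self]) (Algebra.IsAlgebraic.isAlgebraic y)
  rwa [hd, sub_eq_zero] at this

theorem Derivation.map_prod_div {F ι : Type*} [Field F] (D : Derivation ℤ F F) (s : Finset ι)
    (f : ι → F) (hf : ∀ i ∈ s, f i ≠ 0) :
    D (∏ i ∈ s, f i) / ∏ i ∈ s, f i = ∑ i ∈ s, D (f i) / f i := by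
  let : Differential F := ⟨D⟩
  exact Differential.logDeriv_prod ι s f hf

theorem exists_sum_logDeriv_eq_zero_of_isAlgebraic {k F ι : Type*} [Field k] [Field F] [CharZero F]
    [Algebra k F] [Algebra.IsAlgebraic k F] [Fintype ι] (D : Derivation ℤ F F)
    (hDk : ∀ r : k, ∃ r' : k, D (algebraMap k F r) = algebraMap k F r') (b : ι → k)
    (u : ι → F) (hu : ∀ i, u i ≠ 0) (v : F)
    (h : ∑ i, algebraMap k F (b i) * (D (u i) / u i) + D v = 0) :
    ∃ (N : ι → k) (T : k), ∃ e > 0, (∀ i, N i ≠ 0) ∧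
      (∀ i x, u i = algebraMap k F x → N i = x ^ e) ∧
      ∑ i, algebraMap k F (b i) * (D (algebraMap k F (N i)) / algebraMap k F (N i)) +
        D (algebraMap k F T) = 0 := by
  have : CharZero k := (algebraMap k F).charZero
  let Ω := AlgebraicClosure F
  obtain ⟨E, hE⟩ := @exists_derivation_extension F Ω _ _ _ (formallySmooth_of_charZero F Ω)
    ((Algebra.linearMap F Ω).compDer D)
  replace hE (x : F) : E (algebraMap F Ω x) = algebraMap F Ω (D x) := hE x
  have hcomm (σ : F →ₐ[k] Ω) (y : F) : σ (D y) = E (σ y) := by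
    refine σ.map_derivation_of_isAlgebraic D E (fun r ↦ ?_) y
    obtain ⟨r', hr'⟩ := hDk r
    rw [hr', σ.commutes, IsScalarTower.algebraMap_apply k F Ω, IsScalarTower.algebraMap_apply k F Ω,
      hE, hr']
  let S : Set F := insert v (Set.range u)
  let L := IntermediateField.adjoin k S
  have hfin : Finite S := ((Set.finite_range u).insert v).to_subtype
  have : FiniteDimensional k L := IntermediateField.finiteDimensional_adjoin fun x _ ↦
    (Algebra.IsAlgebraic.isAlgebraic (R := k) x).isIntegral
  let u' (i : ι) : L := ⟨u i, IntermediateField.subset_adjoin k S (Or.inr ⟨i, rfl⟩)⟩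
  let v' : L := ⟨v, IntermediateField.subset_adjoin k S (Or.inl rfl)⟩
  have hu' (i) : u' i ≠ 0 := fun h ↦ hu i (congrArg Subtype.val h)
  have hσ (σ : L →ₐ[k] Ω) :
      ∑ i, algebraMap k Ω (b i) * (E (σ (u' i)) / σ (u' i)) + E (σ v') = 0 := by
    obtain ⟨τ, hτ⟩ := IntermediateField.exists_algHom_of_adjoin_splits (S := (Set.univ : Set F))
      (fun s _ ↦ ⟨(Algebra.IsAlgebraic.isAlgebraic (R := k) s).isIntegral, IsAlgClosed.splits _⟩)
      σ (IntermediateField.adjoin_univ k F)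
    have hτu (x : L) : σ x = τ x := by rw [← hτ]; rfl
    have := congrArg τ h
    simp only [map_add, map_sum, map_mul, map_div₀, AlgHom.commutes, hcomm, map_zero] at this
    simpa only [hτu] using this
  have hkE (x : k) : E (algebraMap k Ω x) = algebraMap F Ω (D (algebraMap k F x)) := by
    rw [IsScalarTower.algebraMap_apply k F Ω, hE]
  refine ⟨fun i ↦ Algebra.norm k (u' i), Algebra.trace k L v', Module.finrank k L,
    Module.finrank_pos, fun i ↦ ?_, fun i x hx ↦ ?_, ?_⟩
  · exact Algebra.norm_ne_zero_iff.2 (hu' i)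
  · have : u' i = algebraMap k L x := Subtype.ext hx
    exact (congrArg _ this).trans (Algebra.norm_algebraMap x)
  · apply (algebraMap F Ω).injective
    simp only [map_add, map_sum, map_mul, map_div₀, ← hkE, map_zero,
      ← IsScalarTower.algebraMap_apply k F Ω, Algebra.norm_eq_prod_embeddings k Ω,
      trace_eq_sum_embeddings Ω]
    have hprod (i) : E (∏ σ : L →ₐ[k] Ω, σ (u' i)) / ∏ σ : L →ₐ[k] Ω, σ (u' i) =
        ∑ σ : L →ₐ[k] Ω, E (σ (u' i)) / σ (u' i) :=
      E.map_prod_div _ _ fun σ _ ↦ (map_ne_zero σ).2 (hu' i)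
    simp only [hprod, Finset.mul_sum]
    rw [Finset.sum_comm, ← Finset.sum_add_distrib]
    exact Finset.sum_eq_zero fun σ _ ↦ hσ σ

/-- If `t` is a uniformizer of `O` and `D = d/dt`, the residue of a sum of logarithmic derivatives
and a derivative is the corresponding sum of orders. -/
theorem sum_mul_ord_eq_zero {F ι : Type*} [Field F] [CharZero F] [Fintype ι] (D : Derivation ℤ F F)
    (O : Subring F) {t : F} (ht : t ∈ O) (ht' : t⁻¹ ∉ O) (hDt : D t = 1)
    (hDO : ∀ x ∈ O, D x ∈ O) (hO : ∀ n : ℤ, n ≠ 0 → (n : F)⁻¹ ∈ O) (b : ι → F) (hb : ∀ i, b i ∈ O)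
    (e : ι → ℤ) (w : ι → F) (hw : ∀ i, w i ∈ O) (hw' : ∀ i, (w i)⁻¹ ∈ O) (hw0 : ∀ i, w i ≠ 0)
    (hbe : (∑ i, b i * e i)⁻¹ ∈ O) (T : F)
    (hT : T = 0 ∨ ∃ (a : ℤ) (x : F), x ∈ O ∧ x⁻¹ ∈ O ∧ x ≠ 0 ∧ T = t ^ a * x)
    (h : ∑ i, b i * (D (t ^ e i * w i) / (t ^ e i * w i)) + D T = 0) :
    ∑ i, b i * (e i : F) = 0 := by
  have ht0 : t ≠ 0 := by rintro rfl; simp at hDt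
  have hlog (a : ℤ) (x : F) (hx : x ≠ 0) :
      D (t ^ a * x) / (t ^ a * x) = a * t⁻¹ + D x * x⁻¹ := by
    have : t ^ a ≠ 0 := zpow_ne_zero a ht0
    have hz : D (t ^ a) = a * t ^ a * t⁻¹ := by
      rw [D.leibniz_zpow, hDt, zpow_sub_one₀ ht0]
      simp [mul_assoc]
    rw [D.leibniz, hz]
    simp only [smul_eq_mul]
    field_simp
    ring
  have hr : ∃ r ∈ O, (∑ i, b i * (e i : F)) * t⁻¹ + r + D T = 0 := by
    refine ⟨∑ i, b i * (D (w i) * (w i)⁻¹), sum_mem fun i _ ↦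
      mul_mem (hb i) (mul_mem (hDO _ (hw i)) (hw' i)), ?_⟩
    rw [← h, Finset.sum_mul, ← Finset.sum_add_distrib]
    congr 1
    refine Finset.sum_congr rfl fun i _ ↦ ?_
    rw [hlog _ _ (hw0 i)]
    ring
  obtain ⟨r, hrO, hr⟩ := hr
  by_contra hs
  have hreg (hDT : D T ∈ O) : False := by
    refine ht' ?_
    have : t⁻¹ = -(∑ i, b i * (e i : F))⁻¹ * (r + D T) := by
      field_simp
      field_simp at hr
      linear_combination hr
    rw [this]
    exact mul_mem (neg_mem hbe) (add_mem hrO hDT)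
  obtain rfl | ⟨a, x, hx, hx', hx0, rfl⟩ := hT
  · exact hreg (by simp)
  obtain ⟨n, rfl | rfl⟩ := a.eq_nat_or_neg
  · exact hreg (hDO _ (mul_mem (by simpa using pow_mem ht n) hx))
  rcases n.eq_zero_or_pos with rfl | hn
  · exact hreg (hDO _ (by simpa using hx))
  obtain ⟨n, rfl⟩ := Nat.exists_eq_succ_of_ne_zero hn.ne'
  have hD := hlog (-((n + 1 : ℕ) : ℤ)) x hx0
  rw [div_eq_iff (mul_ne_zero (zpow_ne_zero _ ht0) hx0)] at hD
  rw [hD, zpow_neg, zpow_natCast] at hr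
  refine ht' ?_
  have hne : ((n + 1 : ℕ) : F) ≠ 0 := Nat.cast_ne_zero.2 n.succ_ne_zero
  have : t⁻¹ = ((n + 1 : ℕ) : F)⁻¹ * x⁻¹ *
      ((∑ i, b i * (e i : F)) * t ^ n + r * t ^ (n + 1) + D x) := by
    push_cast at hr hne ⊢
    field_simp
    field_simp at hr
    linear_combination -hr
  rw [this]
  refine mul_mem (mul_mem ?_ hx') (add_mem (add_mem (mul_mem (sum_mem fun i _ ↦ mul_mem (hb i)
    (intCast_mem O _)) (pow_mem ht _)) (mul_mem hrO (pow_mem ht _))) (hDO _ hx))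
  simpa using hO ((n + 1 : ℕ) : ℤ) (by omega)

theorem exists_intermediateField_transcendental {C F : Type*} [Field C] [Field F] [Algebra C F]
    {t : F} (ht : Transcendental C t) : ∃ K : IntermediateField C F, Transcendental K t ∧
      Algebra.IsAlgebraic (IntermediateField.adjoin K {t}) F := by
  obtain ⟨B, htB, hB⟩ := exists_isTranscendenceBasis_superset (R := C) (s := {t}) <| by
    rw [AlgebraicIndepOn, algebraicIndependent_singleton_iff ⟨t, rfl⟩]
    exact ht
  rw [Set.singleton_subset_iff] at htB
  refine ⟨IntermediateField.adjoin C (B \ {t}), ?_, ?_⟩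
  · have := hB.1.transcendental_adjoin (s := {x : B | (x : F) ≠ t}) (i := ⟨t, htB⟩) (by simp)
    have himg : (Subtype.val '' {x : B | (x : F) ≠ t}) = B \ {t} := by
      ext x
      simp [and_comm]
    rw [himg] at this
    exact IntermediateField.transcendental_adjoin_iff.2 this
  · have := hB.isAlgebraic_field
    rw [Subtype.range_coe] at this
    have hle : IntermediateField.adjoin C B ≤
        (IntermediateField.adjoin (IntermediateField.adjoin C (B \ {t})) {t}).restrictScalars C := by
      rw [IntermediateField.adjoin_adjoin_left, Set.sdiff_union_self]
      exact IntermediateField.adjoin.mono _ _ _ Set.subset_union_left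
    let φ := (IntermediateField.inclusion hle).toRingHom
    let : Algebra (IntermediateField.adjoin C B)
      (IntermediateField.adjoin (IntermediateField.adjoin C (B \ {t})) {t}) := φ.toAlgebra
    have : IsScalarTower (IntermediateField.adjoin C B)
      (IntermediateField.adjoin (IntermediateField.adjoin C (B \ {t})) {t}) F :=
    .of_algebraMap_eq' rfl
    exact Algebra.IsAlgebraic.tower_top (K := IntermediateField.adjoin C B) _

/-- The ring of fractions `g(t) / h(t)` over `K` with `h(0) ≠ 0`. -/
def localRingAtZero (K : Type*) {F : Type*} [Field K] [Field F] [Algebra K F] (t : F) :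
    Subring F where
  carrier := {x | ∃ g h : Polynomial K, h.eval 0 ≠ 0 ∧
    x * Polynomial.aeval t h = Polynomial.aeval t g}
  mul_mem' := by
    rintro x y ⟨g, h, h0, hx⟩ ⟨g', h', h0', hy⟩
    refine ⟨g * g', h * h', by simp [h0, h0'], ?_⟩
    rw [map_mul, map_mul, ← hx, ← hy]
    ring
  one_mem' := ⟨1, 1, by simp⟩
  add_mem' := by
    rintro x y ⟨g, h, h0, hx⟩ ⟨g', h', h0', hy⟩
    refine ⟨g * h' + g' * h, h * h', by simp [h0, h0'], ?_⟩
    rw [map_mul, map_add, map_mul, map_mul, ← hx, ← hy]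
    ring
  zero_mem' := ⟨0, 1, by simp⟩
  neg_mem' := by
    rintro x ⟨g, h, h0, hx⟩
    exact ⟨-g, h, h0, by rw [map_neg, ← hx, neg_mul]⟩

section localRingAtZero

variable {K F : Type*} [Field K] [Field F] [Algebra K F] {t : F}

open Polynomial

theorem aeval_mem_localRingAtZero (g : K[X]) : aeval t g ∈ localRingAtZero K t :=
  ⟨g, 1, by simp⟩

theorem inv_aeval_mem_localRingAtZero {h : K[X]} (h0 : h.eval 0 ≠ 0) :
    (aeval t h)⁻¹ ∈ localRingAtZero K t := by
  by_cases ht : aeval t h = 0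
  · rw [ht, inv_zero]
    exact zero_mem _
  · exact ⟨1, h, h0, by simp [ht]⟩

theorem algebraMap_mem_localRingAtZero (c : K) : algebraMap K F c ∈ localRingAtZero K t := by
  simpa using aeval_mem_localRingAtZero (t := t) (C c)

theorem inv_notMem_localRingAtZero (ht : Transcendental K t) : t⁻¹ ∉ localRingAtZero K t := by
  rintro ⟨g, h, h0, hx⟩
  have ht0 : t ≠ 0 := by
    rintro rfl
    exact ht isAlgebraic_zero
  refine h0 ?_
  have : h = X * g := by
    apply transcendental_iff_injective.1 ht
    rw [map_mul, ← hx, aeval_X, mul_inv_cancel_left₀ ht0]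
  simp [this]

theorem map_mem_localRingAtZero {D : Derivation ℤ F F}
    (hD : ∀ c : K, D (algebraMap K F c) = 0) (hDt : D t = 1) {x : F}
    (hx : x ∈ localRingAtZero K t) : D x ∈ localRingAtZero K t := by
  obtain ⟨g, h, h0, hx⟩ := hx
  have key := congrArg D hx
  rw [D.leibniz, D.map_polynomial_aeval hD, D.map_polynomial_aeval hD, hDt] at key
  refine ⟨derivative g * h - g * derivative h, h * h, by simp [h0], ?_⟩
  simp only [map_mul, map_sub, ← hx, smul_eq_mul, mul_one] at key ⊢
  rw [← key]
  ring

theorem exists_zpow_mul_of_mem_adjoin (ht : Transcendental K t) {x : F}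
    (hx : x ∈ IntermediateField.adjoin K {t}) (hx0 : x ≠ 0) :
    ∃ (a : ℤ) (w : F), w ∈ localRingAtZero K t ∧ w⁻¹ ∈ localRingAtZero K t ∧ w ≠ 0 ∧
      x = t ^ a * w := by
  have ht0 : t ≠ 0 := by
    rintro rfl
    exact ht isAlgebraic_zero
  have hpoly (p : K[X]) (hp : p ≠ 0) :
      ∃ (n : ℕ) (q : K[X]), q.eval 0 ≠ 0 ∧ aeval t p = t ^ n * aeval t q := by
    obtain ⟨q, hq, hdvd⟩ := exists_eq_pow_rootMultiplicity_mul_and_not_dvd p hp 0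
    refine ⟨Polynomial.rootMultiplicity 0 p, q, fun h ↦ hdvd (dvd_iff_isRoot.2 h), ?_⟩
    conv_lhs => rw [hq]
    simp
  obtain ⟨r, s, rfl⟩ := (IntermediateField.mem_adjoin_simple_iff K x).1 hx
  have hr : r ≠ 0 := by rintro rfl; simp at hx0
  have hs : s ≠ 0 := by rintro rfl; simp at hx0
  obtain ⟨n, q, hq, hrq⟩ := hpoly r hr
  obtain ⟨n', q', hq', hsq⟩ := hpoly s hs
  rw [div_ne_zero_iff, hrq, hsq, mul_ne_zero_iff, mul_ne_zero_iff] at hx0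
  refine ⟨n - n', aeval t q * (aeval t q')⁻¹, mul_mem (aeval_mem_localRingAtZero _)
    (inv_aeval_mem_localRingAtZero hq'), ?_, mul_ne_zero hx0.1.2 (inv_ne_zero hx0.2.2), ?_⟩
  · rw [mul_inv_rev, inv_inv]
    exact mul_mem (aeval_mem_localRingAtZero _) (inv_aeval_mem_localRingAtZero hq)
  · rw [hrq, hsq, zpow_sub₀ ht0, zpow_natCast, zpow_natCast]
    field_simp

theorem map_mem_adjoin_simple {D : Derivation ℤ F F}
    (hD : ∀ c : K, D (algebraMap K F c) = 0) (hDt : D t = 1) {x : F}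
    (hx : x ∈ IntermediateField.adjoin K {t}) : D x ∈ IntermediateField.adjoin K {t} := by
  have hmem (p : K[X]) : aeval t p ∈ IntermediateField.adjoin K {t} :=
    (IntermediateField.mem_adjoin_simple_iff K _).2 ⟨p, 1, by simp⟩
  obtain ⟨r, s, rfl⟩ := (IntermediateField.mem_adjoin_simple_iff K x).1 hx
  rw [D.leibniz_div, D.map_polynomial_aeval hD, D.map_polynomial_aeval hD, hDt]
  simp only [smul_eq_mul, mul_one]
  exact mul_mem (pow_mem (inv_mem (hmem _)) _)
    (sub_mem (mul_mem (hmem _) (hmem _)) (mul_mem (hmem _) (hmem _)))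

end localRingAtZero

theorem isAlgebraic_of_sum_logDeriv_eq_zero {C F ι : Type*} [Field C] [Field F] [CharZero F]
    [Algebra C F] [Fintype ι] {b : ι → C} (hb : LinearIndependent ℤ b) {u : ι → F}
    (hu : ∀ i, u i ≠ 0) {v : F}
    (h : ∀ δ : Derivation ℤ F F, (∀ r : C, δ (algebraMap C F r) = 0) →
      ∑ i, algebraMap C F (b i) * (δ (u i) / u i) + δ v = 0) (i₀ : ι) :
    IsAlgebraic C (u i₀) := by
  by_contra ht
  obtain ⟨K, htK, hK⟩ := exists_intermediateField_transcendental ht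
  obtain ⟨D, hDK, hDt⟩ := exists_derivation_eq_one_of_transcendental htK
  set t := u i₀ with ht_def
  have hDC (r : C) : D (algebraMap C F r) = 0 := hDK (algebraMap C K r)
  let k := IntermediateField.adjoin K {t}
  let b' (i : ι) : k := algebraMap K k (algebraMap C K (b i))
  have hb' (i : ι) : algebraMap k F (b' i) = algebraMap C F (b i) := rfl
  obtain ⟨N, T, e, he, hN, hNu, hsum⟩ := exists_sum_logDeriv_eq_zero_of_isAlgebraic (k := k) D
    (fun r ↦ ⟨⟨_, map_mem_adjoin_simple hDK hDt r.2⟩, rfl⟩) b' u hu v (h D hDC)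
  have hN0 (i : ι) : algebraMap k F (N i) ≠ 0 := (map_ne_zero _).2 (hN i)
  choose a w hw hw' hw0 hNw using fun i ↦ exists_zpow_mul_of_mem_adjoin htK (N i).2 (hN0 i)
  replace hNw (i : ι) : algebraMap k F (N i) = t ^ a i * w i := hNw i
  have hC (c : C) : algebraMap C F c ∈ localRingAtZero K t :=
    algebraMap_mem_localRingAtZero (algebraMap C K c)
  have hbe : ∑ i, algebraMap C F (b i) * (a i : F) = algebraMap C F (∑ i, b i * a i) := by simp
  have hres := sum_mul_ord_eq_zero D (localRingAtZero K t)
    (by simpa using aeval_mem_localRingAtZero (K := K) (t := t) Polynomial.X)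
    (inv_notMem_localRingAtZero htK) hDt (fun x hx ↦ map_mem_localRingAtZero hDK hDt hx)
    (fun n _ ↦ by simpa using hC (n : C)⁻¹) (fun i ↦ algebraMap C F (b i)) (fun i ↦ hC _)
    a w hw hw' hw0 (by rw [hbe, ← map_inv₀]; exact hC _) (algebraMap k F T)
    (by
      by_cases hT : algebraMap k F T = 0
      · exact .inl hT
      · exact .inr (exists_zpow_mul_of_mem_adjoin htK T.2 hT))
    (by simpa only [hNw, hb'] using hsum)
  rw [hbe, map_eq_zero] at hres
  have ha : a i₀ = 0 := Fintype.linearIndependent_iff.1 hb a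
    (by simpa only [zsmul_eq_mul, mul_comm] using hres) i₀
  have hNt : algebraMap k F (N i₀) = t ^ e := by
    rw [hNu i₀ ⟨t, IntermediateField.mem_adjoin_simple_self K t⟩ rfl, map_pow]
    rfl
  have hte : (t ^ e)⁻¹ ∈ localRingAtZero K t := by
    rw [← hNt, hNw, ha, zpow_zero, one_mul]
    exact hw' i₀
  refine inv_notMem_localRingAtZero htK ?_
  have : t⁻¹ = t ^ (e - 1) * (t ^ e)⁻¹ := by
    obtain ⟨e, rfl⟩ := Nat.exists_eq_succ_of_ne_zero he.ne'
    have : t ≠ 0 := hu i₀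
    simp [pow_succ]
    field_simp
  rw [this]
  exact mul_mem (by simpa using aeval_mem_localRingAtZero (K := K) (t := t) (Polynomial.X ^ (e - 1)))
    hte

theorem exists_ne_zero_forall_map_eq_zero {F ι : Type*} [Field F] [Fintype ι]
    (D : Derivation ℤ F F) {A : Submodule F (ι → F)} (hA : A ≠ ⊥)
    (hD : ∀ a ∈ A, (fun i ↦ D (a i)) ∈ A) : ∃ c ∈ A, c ≠ 0 ∧ ∀ i, D (c i) = 0 := by
  classical
  let p (d : ℕ) : Prop := ∃ a ∈ A, a ≠ 0 ∧ (Finset.univ.filter fun i ↦ a i ≠ 0).card = d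
  have hp : ∃ d, p d := by
    obtain ⟨a, ha, ha0⟩ := A.exists_mem_ne_zero_of_ne_bot hA
    exact ⟨_, a, ha, ha0, rfl⟩
  obtain ⟨a, ha, ha0, hcard⟩ := Nat.find_spec hp
  obtain ⟨i₀, hi₀⟩ := Function.ne_iff.1 ha0
  rw [Pi.zero_apply] at hi₀
  refine ⟨(a i₀)⁻¹ • a, A.smul_mem _ ha, smul_ne_zero (inv_ne_zero hi₀) ha0, ?_⟩
  by_contra! hne
  obtain ⟨j, hj⟩ := hne
  refine Nat.find_min hp ?_ ⟨_, hD _ (A.smul_mem (a i₀)⁻¹ ha), fun h ↦ hj (congrFun h j), rfl⟩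
  rw [← hcard]
  refine Finset.card_lt_card (Finset.ssubset_iff_of_subset ?_ |>.2 ⟨i₀, ?_, ?_⟩)
  · intro i hi
    simp only [Finset.mem_filter_univ] at hi ⊢
    contrapose! hi
    simp [hi]
  · simpa using hi₀
  · have : D (((a i₀)⁻¹ • a) i₀) = 0 := by
      rw [Pi.smul_apply, smul_eq_mul, inv_mul_cancel₀ hi₀, D.map_one_eq_zero]
    simpa only [Finset.mem_filter_univ, not_not] using this

/-- The differential forms `dyᵢ / yᵢ - dxᵢ`, regarded as functionals on derivations. -/
def expForm {F ι : Type*} [Field F] (x y : ι → F) : Derivation ℤ F F →ₗ[F] (ι → F) where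
  toFun δ i := δ (y i) / y i - δ (x i)
  map_add' δ ε := by ext i; simp; ring
  map_smul' r δ := by ext i; simp; ring

section expForm

variable {F ι : Type*} [Field F]

theorem expForm_apply (x y : ι → F) (δ : Derivation ℤ F F) (i : ι) :
    expForm x y δ i = δ (y i) / y i - δ (x i) := rfl

theorem Derivation.map_zpow_div (D : Derivation ℤ F F) {y : F} (hy : y ≠ 0) (a : ℤ) :
    D (y ^ a) / y ^ a = a * (D y / y) := by
  have : y ^ a ≠ 0 := zpow_ne_zero a hy
  rw [D.leibniz_zpow, zpow_sub_one₀ hy]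
  simp only [zsmul_eq_mul, smul_eq_mul]
  field_simp

theorem map_expForm_apply {x y : ι → F} {D : Derivation ℤ F F} (hy : ∀ i, y i ≠ 0)
    (hxy : ∀ i, D (y i) = y i * D (x i)) (δ : Derivation ℤ F F) (i : ι) :
    D (expForm x y δ i) = expForm x y ⁅D, δ⁆ i := by
  have := hy i
  rw [expForm_apply, expForm_apply, map_sub, D.leibniz_div, Derivation.commutator_apply,
    Derivation.commutator_apply, hxy, δ.leibniz]
  simp only [smul_eq_mul]
  field_simp
  ring

theorem lie_mem_derivationsOver_constants {D δ : Derivation ℤ F F}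
    (hδ : δ ∈ derivationsOver (D.constants : Set F)) :
    ⁅D, δ⁆ ∈ derivationsOver (D.constants : Set F) := by
  intro c hc
  rw [Derivation.commutator_apply, hδ c hc, Derivation.mem_constants.1 hc, map_zero, map_zero,
    sub_zero]

variable [CharZero F] [Fintype ι]

theorem eq_zero_of_sum_mul_expForm_eq_zero {x y : ι → F} {D : Derivation ℤ F F}
    (hy : ∀ i, y i ≠ 0) (hxy : ∀ i, D (y i) = y i * D (x i))
    (hli : LinearIndependent ℤ fun i ↦ D (x i)) (c : ι → D.constants)
    (hc : ∀ δ ∈ derivationsOver (D.constants : Set F), ∑ i, (c i : F) * expForm x y δ i = 0) :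
    c = 0 := by
  let M := Submodule.span ℤ (Set.range c)
  have hcM (i : ι) : c i ∈ M := Submodule.subset_span ⟨i, rfl⟩
  have : Module.Finite ℤ M := Module.Finite.span_of_finite ℤ (Set.finite_range c)
  have : Module.Free ℤ M := Module.free_of_finite_type_torsion_free'
  let b := Module.finBasis ℤ M
  let m (i : ι) (k : Fin (Module.finrank ℤ M)) : ℤ := b.repr ⟨c i, hcM i⟩ k
  have hm (i : ι) : (c i : F) = ∑ k, m i k * ((b k : D.constants) : F) := by
    let φ : M →+ F := D.constants.subtype.toAddMonoidHom.comp M.subtype.toAddMonoidHom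
    refine (congrArg φ (b.sum_repr ⟨c i, hcM i⟩)).symm.trans ?_
    simp only [map_sum, map_zsmul, zsmul_eq_mul]
    rfl
  let u (k : Fin (Module.finrank ℤ M)) : F := ∏ i, y i ^ m i k
  have hu (k) : u k ≠ 0 := Finset.prod_ne_zero_iff.2 fun i _ ↦ zpow_ne_zero _ (hy i)
  have hlog (δ : Derivation ℤ F F) (k) : δ (u k) / u k = ∑ i, m i k * (δ (y i) / y i) := by
    rw [δ.map_prod_div _ _ fun i _ ↦ zpow_ne_zero _ (hy i)]
    exact Finset.sum_congr rfl fun i _ ↦ δ.map_zpow_div (hy i) _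
  have halg (k) : IsAlgebraic D.constants (u k) := by
    refine isAlgebraic_of_sum_logDeriv_eq_zero (b := fun k ↦ (b k : D.constants))
      (b.linearIndependent.map' M.subtype M.ker_subtype) hu (v := -∑ i, c i * x i)
      (fun δ hδ ↦ ?_) k
    have hδ' (r : D.constants) : δ r = 0 := hδ r
    rw [← hc δ fun r hr ↦ hδ ⟨r, hr⟩]
    simp only [hlog, map_neg, map_sum, δ.leibniz, hδ', smul_eq_mul, mul_zero, add_zero,
      expForm_apply, mul_sub, Finset.sum_sub_distrib, ← sub_eq_add_neg, Finset.mul_sum]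
    rw [Finset.sum_comm]
    congr 1
    refine Finset.sum_congr rfl fun i _ ↦ ?_
    rw [hm, Finset.sum_mul]
    refine Finset.sum_congr rfl fun k _ ↦ ?_
    change ((b k : D.constants) : F) * _ = _
    ring
  have hm0 (i k) : m i k = 0 := by
    refine Fintype.linearIndependent_iff.1 hli (fun i ↦ m i k) ?_ i
    have h0 := hlog D k
    rw [D.map_eq_zero_of_isAlgebraic (fun r ↦ r.2) (halg k), zero_div] at h0
    rw [h0]
    refine Finset.sum_congr rfl fun i _ ↦ ?_
    rw [hxy, mul_div_cancel_left₀ _ (hy i), zsmul_eq_mul]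
  ext i
  simp [hm, hm0]

theorem map_expForm_derivationsOver_constants {x y : ι → F} {D : Derivation ℤ F F}
    (hy : ∀ i, y i ≠ 0) (hxy : ∀ i, D (y i) = y i * D (x i))
    (hli : LinearIndependent ℤ fun i ↦ D (x i)) :
    (derivationsOver (D.constants : Set F)).map (expForm x y) = ⊤ := by
  classical
  by_contra hne
  obtain ⟨ℓ, hℓ0, hℓ⟩ := Submodule.exists_le_ker_of_lt_top _ (lt_top_iff_ne_top.2 hne)
  let A : Submodule F (ι → F) :=
    { carrier := {a | ∀ δ ∈ derivationsOver (D.constants : Set F), ∑ i, a i * expForm x y δ i = 0}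
      add_mem' := fun ha hb δ hδ ↦ by
        simp [add_mul, Finset.sum_add_distrib, ha δ hδ, hb δ hδ]
      zero_mem' := fun δ _ ↦ by simp
      smul_mem' := fun r a ha δ hδ ↦ by
        simp [mul_assoc, ← Finset.mul_sum, ha δ hδ] }
  have hA : A ≠ ⊥ := by
    refine fun h ↦ hℓ0 ?_
    have : (fun i ↦ ℓ (Pi.single i 1)) ∈ A := fun δ hδ ↦ by
      have := hℓ (Submodule.mem_map_of_mem hδ)
      rw [LinearMap.mem_ker, LinearMap.pi_apply_eq_sum_univ] at this
      rw [← this]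
      refine Finset.sum_congr rfl fun i _ ↦ ?_
      rw [smul_eq_mul, mul_comm]
      congr! with k
      simp [Pi.single_apply, eq_comm]
    rw [h, Submodule.mem_bot] at this
    exact LinearMap.pi_ext' fun i ↦ LinearMap.ext_ring (congrFun this i)
  obtain ⟨c, hcA, hc0, hc⟩ := exists_ne_zero_forall_map_eq_zero D hA fun a ha δ hδ ↦ by
    have h₁ := congrArg D (ha δ hδ)
    have h₂ := ha _ (lie_mem_derivationsOver_constants hδ)
    simp only [map_sum, D.leibniz, smul_eq_mul, map_expForm_apply hy hxy, map_zero,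
      Finset.sum_add_distrib, h₂, zero_add] at h₁
    simpa only [mul_comm] using h₁
  have := eq_zero_of_sum_mul_expForm_eq_zero hy hxy hli (fun i ↦ ⟨c i, hc i⟩) hcA
  exact hc0 (funext fun i ↦ congrArg Subtype.val (congrFun this i))

end expForm

theorem card_add_one_le_relLength_derivationsOver {F ι : Type*} [Field F] [CharZero F] [Fintype ι]
    [Nonempty ι] {x y : ι → F} {D : Derivation ℤ F F} (hy : ∀ i, y i ≠ 0)
    (hxy : ∀ i, D (y i) = y i * D (x i)) (hli : LinearIndependent ℤ fun i ↦ D (x i)) :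
    (Fintype.card ι : ℕ∞) + 1 ≤ (derivationsOver (D.constants : Set F)).relLength
      (derivationsOver (Set.range x ∪ Set.range y)) := by
  have hle : derivationsOver (Set.range x ∪ Set.range y) ≤ LinearMap.ker (expForm x y) := by
    intro δ hδ
    ext i
    simp [expForm_apply, hδ (x i) (.inl ⟨i, rfl⟩), hδ (y i) (.inr ⟨i, rfl⟩)]
  rw [← inf_eq_right.2 hle, Submodule.relLength_inf, Submodule.relLength_ker_of_map_eq_top _
    (map_expForm_derivationsOver_constants hy hxy hli)]
  gcongr
  refine Submodule.one_le_relLength fun h ↦ ?_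
  have hD : D ∈ derivationsOver (D.constants : Set F) ⊓ LinearMap.ker (expForm x y) := by
    refine ⟨fun c hc ↦ hc, ?_⟩
    ext i
    simp [expForm_apply, hxy, hy i]
  exact hli.ne_zero (Classical.arbitrary ι) (h hD _ (.inl ⟨_, rfl⟩))

/-- A subfield of `ℝ` as a rational vector space. -/
def Subfield.ratSubmodule (E : Subfield ℝ) : Submodule ℚ ℝ where
  carrier := E
  add_mem' := E.add_mem
  zero_mem' := E.zero_mem
  smul_mem' q x hx := by
    rw [Rat.smul_def]
    exact E.mul_mem (SubfieldClass.ratCast_mem E q) hx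

/-- The union of a set and its image under the exponential. -/
def expGraph (V : Set ℝ) : Set ℝ := V ∪ Real.exp '' V

theorem expGraph_mono {V W : Set ℝ} (h : V ⊆ W) : expGraph V ⊆ expGraph W :=
  Set.union_subset_union h (Set.image_mono h)

/-- The failure of a derivation to respect the exponential. -/
noncomputable def expDefect (D : Derivation ℤ ℝ ℝ) : ℝ →ₗ[ℚ] ℝ :=
  AddMonoidHom.toRatLinearMap <| AddMonoidHom.mk' (fun v ↦ D (Real.exp v) / Real.exp v - D v) <| by
    intro v w
    rw [Real.exp_add, D.leibniz, map_add]
    simp only [smul_eq_mul]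
    field_simp [Real.exp_ne_zero]
    ring

theorem mem_ker_expDefect {D : Derivation ℤ ℝ ℝ} {v : ℝ} :
    v ∈ LinearMap.ker (expDefect D) ↔ D (Real.exp v) = Real.exp v * D v := by
  rw [LinearMap.mem_ker, mul_comm, ← div_eq_iff (Real.exp_ne_zero v)]
  exact sub_eq_zero

theorem relLength_add_le_of_subfield_le {E E' : Subfield ℝ} (hE : E ≤ E') {V : Submodule ℚ ℝ}
    (hexp : ∀ x ∈ V, x ∈ E' → Real.exp x ∈ E') {a b : ℕ∞}
    (ha : (V ⊓ E'.ratSubmodule).relLength E.ratSubmodule + a ≤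
      (derivationsOver (E : Set ℝ)).relLength (derivationsOver (expGraph ↑(V ⊓ E'.ratSubmodule))))
    (hb : V.relLength E'.ratSubmodule + b ≤
      (derivationsOver (E' : Set ℝ)).relLength (derivationsOver (expGraph V))) :
    V.relLength E.ratSubmodule + (a + b) ≤
      (derivationsOver (E : Set ℝ)).relLength (derivationsOver (expGraph V)) := by
  have hinf : V ⊓ E'.ratSubmodule ⊓ E.ratSubmodule = V ⊓ E.ratSubmodule := by
    rw [inf_assoc, inf_eq_right.2 (show E.ratSubmodule ≤ E'.ratSubmodule from hE)]
  rw [← inf_eq_right.2 (derivationsOver_anti (expGraph_mono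
      (SetLike.coe_subset_coe.2 (inf_le_left : V ⊓ E'.ratSubmodule ≤ V)))),
    Submodule.relLength_inf, ← Submodule.relLength_inf_left V E.ratSubmodule, ← hinf,
    Submodule.relLength_add_of_le (Q := V ⊓ E'.ratSubmodule) inf_le_left inf_le_left,
    Submodule.relLength_inf_left, Submodule.relLength_inf_left V, add_add_add_comm]
  refine add_le_add ha (hb.trans ?_)
  refine Submodule.relLength_mono_left (le_inf (derivationsOver_anti hE)
    (derivationsOver_anti ?_)) _
  rintro _ (hx | ⟨x, hx, rfl⟩)
  · exact hx.2
  · exact hexp _ hx.1 hx.2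

theorem relLength_constants_add_one_le {D : Derivation ℤ ℝ ℝ} {V : Submodule ℚ ℝ}
    [FiniteDimensional ℚ V] (hV : V ≤ LinearMap.ker (expDefect D))
    (hD : ¬ V ≤ D.constants.ratSubmodule) :
    V.relLength D.constants.ratSubmodule + 1 ≤ (derivationsOver (D.constants : Set ℝ)).relLength
      (derivationsOver (expGraph V)) := by
  obtain ⟨a, t, ha, htV, hli, -⟩ := V.exists_basis_mod D.constants.ratSubmodule
  have hpos : 0 < a := by
    have := Submodule.one_le_relLength hD
    rw [← ha] at this
    exact_mod_cast this
  have : Nonempty (Fin a) := ⟨⟨0, hpos⟩⟩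
  have hli' : LinearIndependent ℤ fun i ↦ D (t i) := by
    refine Fintype.linearIndependent_iff.2 fun g hg i ↦ ?_
    have := Fintype.linearIndependent_iff.1 hli (fun i ↦ g i) ?_ i
    · exact_mod_cast this
    · simp only [Function.comp_apply, ← map_smul, ← map_sum]
      rw [Submodule.mkQ_apply, Submodule.Quotient.mk_eq_zero]
      change D _ = 0
      rw [map_sum, ← hg]
      exact Finset.sum_congr rfl fun i _ ↦ by rw [Int.cast_smul_eq_zsmul, map_zsmul]
  have := card_add_one_le_relLength_derivationsOver (D := D) (x := t) (y := fun i ↦ Real.exp (t i))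
    (fun i ↦ Real.exp_ne_zero _) (fun i ↦ mem_ker_expDefect.1 (hV (htV i))) hli'
  rw [Fintype.card_fin, ha] at this
  refine this.trans (Submodule.relLength_anti_right _ (derivationsOver_anti ?_))
  rintro _ (⟨i, rfl⟩ | ⟨i, rfl⟩)
  · exact .inl (htV i)
  · exact .inr ⟨t i, htV i, rfl⟩

theorem exists_derivation_of_not_le_expClosure {A : Set ℝ} {V : Submodule ℚ ℝ}
    [FiniteDimensional ℚ V] (hV : ¬ V ≤ (expClosure A).ratSubmodule) :
    ∃ D ∈ derivationsOver (expClosure A : Set ℝ), V ≤ LinearMap.ker (expDefect D) ∧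
      ¬ V ≤ D.constants.ratSubmodule := by
  by_contra! h
  obtain ⟨s, hs⟩ := (Submodule.fg_iff_finiteDimensional V).2 inferInstance
  refine hV ?_
  rw [← hs, Submodule.span_le]
  refine subset_expClosure_of_expRigid s.finite_toSet fun D hD hexp v hv ↦ ?_
  refine h D hD ?_ (hs ▸ Submodule.subset_span hv)
  rw [← hs, Submodule.span_le]
  exact fun t ht ↦ mem_ker_expDefect.2 (hexp t ht)

theorem relLength_expClosure_add_one_le {A : Set ℝ} {V : Submodule ℚ ℝ} [FiniteDimensional ℚ V]
    (hV : ¬ V ≤ (expClosure A).ratSubmodule) :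
    V.relLength (expClosure A).ratSubmodule + 1 ≤
      (derivationsOver (expClosure A : Set ℝ)).relLength (derivationsOver (expGraph V)) := by
  induction hd : Module.finrank ℚ V using Nat.strong_induction_on generalizing V with
  | _ d ih =>
  obtain ⟨D, hDE, hDV, hD⟩ := exists_derivation_of_not_le_expClosure hV
  have hEC : (expClosure A).ratSubmodule ≤ D.constants.ratSubmodule := hDE
  let W := V ⊓ D.constants.ratSubmodule
  have hWV : W < V := inf_lt_left.2 hD
  have : FiniteDimensional ℚ W := Submodule.finiteDimensional_inf_left _ _
  have hW : W.relLength (expClosure A).ratSubmodule ≤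
      (derivationsOver (expClosure A : Set ℝ)).relLength (derivationsOver (expGraph W)) := by
    by_cases hWE : W ≤ (expClosure A).ratSubmodule
    · simp [Submodule.relLength_eq_zero hWE]
    · exact le_self_add.trans (ih _ (hd ▸ Submodule.finrank_lt_finrank_of_lt hWV) hWE rfl)
  rw [← zero_add (1 : ℕ∞)]
  refine relLength_add_le_of_subfield_le hEC (fun x hx hxD ↦ ?_) (by rwa [add_zero])
    (relLength_constants_add_one_le hDV hD)
  rw [Derivation.mem_constants, mem_ker_expDefect.1 (hDV hx), Derivation.mem_constants.1 hxD,
    mul_zero]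

theorem relLength_expClosure_add_le {m : ℕ} {A : ℕ → Set ℝ} (hA : ∀ i, A i ⊆ A (i + 1)) (p : ℕ → ℝ)
    {V : Submodule ℚ ℝ} [FiniteDimensional ℚ V]
    (hp : ∀ i < m, p i ∈ V ∧ p i ∈ A (i + 1) ∧ p i ∉ expClosure (A i)) :
    V.relLength (expClosure (A 0)).ratSubmodule + m ≤
      (derivationsOver (expClosure (A 0) : Set ℝ)).relLength (derivationsOver (expGraph V)) := by
  induction m generalizing A p with
  | zero =>
    rw [Nat.cast_zero, add_zero]
    by_cases hV : V ≤ (expClosure (A 0)).ratSubmodule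
    · simp [Submodule.relLength_eq_zero hV]
    · exact le_self_add.trans (relLength_expClosure_add_one_le hV)
  | succ m ih =>
    have : FiniteDimensional ℚ ↑(V ⊓ (expClosure (A 1)).ratSubmodule) :=
      Submodule.finiteDimensional_inf_left _ _
    obtain ⟨h0, h1, h2⟩ := hp 0 m.succ_pos
    rw [Nat.cast_succ, add_comm (m : ℕ∞)]
    exact relLength_add_le_of_subfield_le (expClosure_mono (hA 0)) (fun x _ ↦ exp_mem_expClosure)
      (relLength_expClosure_add_one_le fun h ↦ h2 (h ⟨h0, subset_expClosure _ h1⟩))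
      (ih (A := fun i ↦ A (i + 1)) (fun i ↦ hA _) (fun i ↦ p (i + 1))
        fun i hi ↦ hp _ (Nat.succ_lt_succ hi))

theorem relLength_expClosure_union_add_le (C : Set ℝ) {m : ℕ} (p : Fin m → ℝ)
    (hp : ∀ i, p i ∉ expClosure (C ∪ p '' {j | j ≠ i})) {V : Submodule ℚ ℝ} [FiniteDimensional ℚ V]
    (hpV : ∀ i, p i ∈ V) :
    V.relLength (expClosure C).ratSubmodule + m ≤
      (derivationsOver (expClosure C : Set ℝ)).relLength (derivationsOver (expGraph V)) := by
  let A (k : ℕ) : Set ℝ := C ∪ p '' {j | (j : ℕ) < k}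
  have hA : A 0 = C := by simp [A]
  have := relLength_expClosure_add_le (m := m) (A := A) (V := V)
    (fun i ↦ Set.union_subset_union_right _ (Set.image_mono fun j (hj : (j : ℕ) < i) ↦
      hj.trans i.lt_succ_self))
    (fun i ↦ if h : i < m then p ⟨i, h⟩ else 0) (fun i hi ↦ by
      rw [dif_pos hi]
      refine ⟨hpV _, .inr ⟨_, i.lt_succ_self, rfl⟩, fun h ↦ hp ⟨i, hi⟩ (expClosure_mono ?_ h)⟩
      exact Set.union_subset_union_right _ (Set.image_mono fun j (hj : (j : ℕ) < i) h ↦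
        hj.ne (congrArg Fin.val h)))
  rwa [hA] at this

theorem algebraicIndependent_of_notMem_expClosure {C : Set ℝ} {ι : Type*} {p : ι → ℝ}
    (hp : ∀ i, p i ∉ expClosure (C ∪ p '' {j | j ≠ i})) :
    AlgebraicIndependent (expClosure C) p := by
  refine algebraicIndependent_of_finite_type' (algebraMap (expClosure C) ℝ).injective
    fun t _ _ i hi halg ↦ hp i ?_
  let E := expClosure (C ∪ p '' {j | j ≠ i})
  have hle : expClosure C ≤ E := expClosure_mono Set.subset_union_left
  let : Algebra (expClosure C) E := (Subfield.inclusion hle).toAlgebra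
  have : IsScalarTower (expClosure C) E ℝ := .of_algebraMap_eq' rfl
  have hsub : Algebra.adjoin (expClosure C) (p '' t) ≤
      (IsScalarTower.toAlgHom (expClosure C) E ℝ).range := by
    rw [Algebra.adjoin_le_iff]
    rintro _ ⟨j, hj, rfl⟩
    exact ⟨⟨p j, subset_expClosure _ (.inr ⟨j, fun h ↦ hi (h ▸ hj), rfl⟩)⟩, rfl⟩
  let φ : Algebra.adjoin (expClosure C) (p '' t) →+* E :=
    { toFun := fun x ↦ ⟨x, by obtain ⟨y, hy⟩ := hsub x.2; exact hy ▸ y.2⟩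
      map_one' := rfl
      map_mul' := fun _ _ ↦ rfl
      map_zero' := rfl
      map_add' := fun _ _ ↦ rfl }
  let : Algebra (Algebra.adjoin (expClosure C) (p '' t)) E := φ.toAlgebra
  have : IsScalarTower (Algebra.adjoin (expClosure C) (p '' t)) E ℝ := .of_algebraMap_eq' rfl
  refine mem_expClosure_of_isAlgebraic (IsAlgebraic.extendScalars (S := E) ?_ halg)
  exact fun x y hxy ↦ Subtype.ext (congrArg (fun z : E ↦ (z : ℝ)) hxy)

theorem exists_aeval_eq_of_mem_subring_closure {A ι : Type*} [CommRing A] {p : ι → A} {x : A}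
    (hx : x ∈ Subring.closure (Set.range p)) :
    ∃ f : MvPolynomial ι ℤ, MvPolynomial.aeval p f = x := by
  have h : Subring.closure (Set.range p) ≤ (MvPolynomial.aeval (R := ℤ) p).toRingHom.range := by
    rw [Subring.closure_le]
    rintro _ ⟨i, rfl⟩
    exact ⟨MvPolynomial.X i, MvPolynomial.aeval_X p i⟩
  exact h hx

theorem AlgebraicIndependent.linearIndependent_subring_closure {E F ι κ : Type*} [Field E] [Field F]
    [Algebra E F] {p : ι → F} (hp : AlgebraicIndependent E p) {x : κ → E}
    (hx : LinearIndependent ℤ x) :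
    LinearIndependent (Subring.closure (Set.range p)) fun k ↦ algebraMap E F (x k) := by
  rw [linearIndependent_iff'] at hx ⊢
  intro s g hg k hk
  choose f hf using fun k ↦ exists_aeval_eq_of_mem_subring_closure (g k).2
  have hmap (h : MvPolynomial ι ℤ) :
      MvPolynomial.aeval p (MvPolynomial.map (Int.castRingHom E) h) = MvPolynomial.aeval p h := by
    rw [MvPolynomial.aeval_def, MvPolynomial.eval₂_map, MvPolynomial.aeval_def]
    congr 1
    exact RingHom.ext_int _ _
  have hsum : ∑ k ∈ s, x k • MvPolynomial.map (Int.castRingHom E) (f k) = 0 := by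
    refine hp.eq_zero_of_aeval_eq_zero _ (Eq.trans ?_ hg)
    rw [map_sum]
    refine Finset.sum_congr rfl fun k _ ↦ ?_
    rw [map_smul, hmap, hf, Algebra.smul_def, mul_comm]
    rfl
  have hf0 : f k = 0 := by
    ext d
    refine hx s (fun k ↦ MvPolynomial.coeff d (f k)) ?_ k hk
    simpa [MvPolynomial.coeff_sum, MvPolynomial.coeff_map, mul_comm] using
      congrArg (MvPolynomial.coeff d) hsum
  rw [← Subtype.coe_inj, ← hf, hf0, map_zero]
  rfl

theorem AlgebraicIndependent.linearIndependent_subfield_closure {E F ι κ : Type*} [Field E]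
    [Field F] [Algebra E F] {p : ι → F} (hp : AlgebraicIndependent E p) {x : κ → E}
    (hx : LinearIndependent ℤ x) :
    LinearIndependent (Subfield.closure (Set.range p)) fun k ↦ algebraMap E F (x k) := by
  let R := Subring.closure (Set.range p)
  let K := Subfield.closure (Set.range p)
  let : Algebra R K := (Subring.inclusion (show R ≤ K.toSubring from
    Subring.closure_le.2 Subfield.subset_closure)).toAlgebra
  have : IsScalarTower R K F := .of_algebraMap_eq' rfl
  have : FaithfulSMul R K := (faithfulSMul_iff_algebraMap_injective R K).2
    fun a b hab ↦ Subtype.ext (congrArg (fun z : K ↦ (z : F)) hab)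
  have : IsFractionRing R K := .of_field R K fun z ↦ by
    obtain ⟨a, ha, b, hb, hz⟩ := Subfield.mem_closure_iff.1 z.2
    exact ⟨⟨a, ha⟩, ⟨b, hb⟩, Subtype.ext hz.symm⟩
  exact (LinearIndependent.iff_fractionRing R K).1 (hp.linearIndependent_subring_closure hx)

theorem td_lt_aleph0 {F : Type*} [Field F] {X Y : Set F} (hX : X.Finite) :
    td X Y < Cardinal.aleph0 := by
  let k := Subfield.closure Y
  let L := IntermediateField.adjoin k X
  let X' : Set L := Subtype.val ⁻¹' X
  have hXL (x : F) (hx : x ∈ X) : x ∈ L := IntermediateField.subset_adjoin k X hx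
  have : Finite X' := (hX.preimage Subtype.val_injective.injOn).to_subtype
  have hle : Subfield.closure (X ∪ Y) ≤ L.toSubfield := by
    rw [Subfield.closure_le, Set.union_subset_iff]
    exact ⟨hXL, fun y hy ↦ L.algebraMap_mem ⟨y, Subfield.subset_closure hy⟩⟩
  have hmem (a : F) (ha : a ∈ Algebra.adjoin k X) : ∃ a' ∈ Algebra.adjoin k X', (a' : F) = a := by
    have : Algebra.adjoin k X ≤ (Algebra.adjoin k X').map L.val := by
      rw [Algebra.adjoin_le_iff]
      exact fun x hx ↦ ⟨⟨x, hXL x hx⟩, Algebra.subset_adjoin hx, rfl⟩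
    exact this ha
  have : Algebra.IsAlgebraic (Algebra.adjoin k X') L := ⟨fun x ↦ by
    obtain ⟨a, ha, b, hb, hx⟩ := IntermediateField.mem_adjoin_iff_div.1 x.2
    obtain ⟨a', ha', rfl⟩ := hmem a ha
    obtain ⟨b', hb', rfl⟩ := hmem b hb
    obtain rfl : x = a' * b'⁻¹ := Subtype.ext (by rw [hx, div_eq_mul_inv]; rfl)
    exact (isAlgebraic_algebraMap (⟨a', ha'⟩ : Algebra.adjoin k X')).mul
      (isAlgebraic_algebraMap (⟨b', hb'⟩ : Algebra.adjoin k X')).inv⟩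
  refine lt_of_le_of_lt ?_ ((Algebra.IsAlgebraic.trdeg_le_cardinalMk k X').trans_lt
    Cardinal.mk_lt_aleph0)
  refine ciSup_le' fun s ↦ ?_
  exact (AlgebraicIndependent.of_comp L.val (x := fun x : s.1 ↦ (⟨x, hle (s.2.1 x.2)⟩ : L))
    s.2.2).cardinalMk_le_trdeg

/-- Evaluation of derivations at a family of elements. -/
def Derivation.evalMap {F ι : Type*} [Field F] (x : ι → F) :
    Derivation ℤ F F →ₗ[F] (ι → F) where
  toFun δ i := δ (x i)
  map_add' _ _ := rfl
  map_smul' _ _ := rfl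

theorem relLength_derivationsOver_le_td {F : Type*} [Field F] [CharZero F] {X Y : Set F}
    (hX : X.Finite) {P : Submodule F (Derivation ℤ F F)} (hP : P ≤ derivationsOver Y) :
    P.relLength (derivationsOver X) ≤ ((td X Y).toNat : ℕ∞) := by
  let k := Subfield.closure Y
  obtain ⟨B, -, ⟨hB, hBX⟩, hmax⟩ := exists_maximal_algebraicIndependent (R := k) ∅ X
    (Set.empty_subset X)
    ((algebraicIndependent_empty_iff ..).2 (FaithfulSMul.algebraMap_injective k F))
  have : Finite B := (hX.subset hBX).to_subtype
  let : Fintype B := Fintype.ofFinite B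
  have hker : P ⊓ LinearMap.ker (Derivation.evalMap ((↑) : B → F)) ≤ derivationsOver X := by
    rintro δ ⟨hδP, hδ⟩ x hx
    have hδk (r : k) : δ r = 0 := by
      have : k ≤ δ.constants := Subfield.closure_le.2 (hP hδP)
      exact this r.2
    have hδB (b : F) (hb : b ∈ B) : δ b = 0 := congrFun hδ ⟨b, hb⟩
    have hδL (r : IntermediateField.adjoin k B) : δ r = 0 := by
      have : Subfield.closure (Set.range (algebraMap k F) ∪ B) ≤ δ.constants := by
        rw [Subfield.closure_le, Set.union_subset_iff]
        refine ⟨?_, hδB⟩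
        rintro _ ⟨r, rfl⟩
        exact hδk r
      exact this r.2
    refine δ.map_eq_zero_of_isAlgebraic hδL ?_
    by_contra hx'
    refine hx' ?_
    have htr : Transcendental (Algebra.adjoin k B) x :=
      IntermediateField.transcendental_adjoin_iff.1 hx'
    have hxB : x ∈ B := hmax ⟨AlgebraicIndepOn.insert hB (by rw [Set.image_id]; exact htr),
      Set.insert_subset hx hBX⟩ (Set.subset_insert x B) (Set.mem_insert x B)
    exact isAlgebraic_algebraMap (⟨x, IntermediateField.subset_adjoin k B hxB⟩ :
      IntermediateField.adjoin k B)
  refine (Submodule.relLength_le_card _ hker).trans ?_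
  have hBtd : Cardinal.mk B ≤ td X Y := le_ciSup_of_le Cardinal.bddAbove_of_small
    ⟨B, hBX.trans (Set.subset_union_left.trans Subfield.subset_closure), hB⟩ le_rfl
  have := Cardinal.toNat_le_toNat hBtd (td_lt_aleph0 hX)
  rw [Cardinal.mk_toNat_eq_card] at this
  exact_mod_cast this

theorem relLength_derivationsOver_range_le {F ι : Type*} [Field F] [Fintype ι] (x : ι → F)
    (P : Submodule F (Derivation ℤ F F)) :
    P.relLength (derivationsOver (Set.range x)) ≤ Fintype.card ι := by
  refine Submodule.relLength_le_card (Derivation.evalMap x) ?_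
  rintro δ ⟨-, hδ⟩ _ ⟨i, rfl⟩
  exact congrFun hδ i

theorem relLength_derivationsOver_le_relLength_span {F : Type*} [Field F] {K : Subfield F}
    {S : Set F} {P : Submodule F (Derivation ℤ F F)} (hP : P ≤ derivationsOver (K ∪ S))
    (U : Submodule K F) [FiniteDimensional K U] :
    P.relLength (derivationsOver (U : Set F)) ≤ U.relLength (Submodule.span K S) := by
  obtain ⟨a, t, ha, -, -, ht⟩ := U.exists_basis_mod (Submodule.span K S)
  rw [← ha, ← Fintype.card_fin a]
  refine Submodule.relLength_le_card (Derivation.evalMap t) ?_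
  rintro δ ⟨hδP, hδ⟩ u hu
  let δK : F →ₗ[K] F :=
    { toFun := δ
      map_add' := map_add δ
      map_smul' := fun r x ↦ by
        have hr : δ (r : F) = 0 := hP hδP _ (.inl r.2)
        simp [Subfield.smul_def, hr] }
  have : Submodule.span K (Set.range t) ⊔ Submodule.span K S ≤ LinearMap.ker δK := by
    rw [sup_le_iff, Submodule.span_le, Submodule.span_le]
    refine ⟨?_, fun s hs ↦ hP hδP _ (.inr hs)⟩
    rintro _ ⟨i, rfl⟩
    exact congrFun hδ i
  exact this (ht hu)

theorem relLength_derivationsOver_expGraph_le {U W : Submodule ℚ ℝ} [FiniteDimensional ℚ U]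
    {P : Submodule ℝ (Derivation ℤ ℝ ℝ)} (hP : P ≤ derivationsOver ↑(U ⊔ W))
    (hW : ∀ δ ∈ P, W ≤ LinearMap.ker (expDefect δ)) :
    P.relLength (derivationsOver (expGraph ↑(U ⊔ W))) ≤ U.relLength W := by
  obtain ⟨a, t, ha, htU, -, ht⟩ := U.exists_basis_mod W
  rw [← ha, ← Fintype.card_fin a]
  refine Submodule.relLength_le_card (Derivation.evalMap fun i ↦ Real.exp (t i)) ?_
  rintro δ ⟨hδP, hδ⟩
  have hle : U ⊔ W ≤ LinearMap.ker (expDefect δ) := by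
    refine (sup_le ht le_sup_right).trans (sup_le (Submodule.span_le.2 ?_) (hW δ hδP))
    rintro _ ⟨i, rfl⟩
    have h0 : δ (Real.exp (t i)) = 0 := congrFun hδ i
    rw [SetLike.mem_coe, mem_ker_expDefect, h0, hP hδP _ (Submodule.mem_sup_left (htU i)), mul_zero]
  rintro _ (hx | ⟨x, hx, rfl⟩)
  · exact hP hδP _ hx
  · rw [mem_ker_expDefect.1 (hle hx), hP hδP _ hx, mul_zero]

theorem relLength_expGraph_span_le (C : Set ℝ) {m n : ℕ} (p : Fin m → ℝ) (z : Fin n → ℝ) :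
    (derivationsOver (expClosure C : Set ℝ)).relLength (derivationsOver (expGraph
      ↑(Submodule.span ℚ (Set.range p) ⊔ Submodule.span ℚ (Set.range z)))) ≤
      m + ((td (Set.range fun i ↦ Real.exp (z i)) (C ∪ Set.range p)).toNat +
        ((Submodule.span (Subfield.closure (Set.range p)) (Set.range z)).relLength
          (Submodule.span (Subfield.closure (Set.range p)) (expClosure C : Set ℝ)) +
        (Submodule.span ℚ (Set.range p)).relLength
          (Submodule.span ℚ (Set.range z) ⊔ (expClosure C).ratSubmodule))) := by
  set K := Subfield.closure (Set.range p)
  set P := Submodule.span ℚ (Set.range p)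
  set Z := Submodule.span ℚ (Set.range z)
  set E := expClosure C
  let ZK := Submodule.span K (Set.range z)
  have : FiniteDimensional ℚ P := FiniteDimensional.span_of_finite ℚ (Set.finite_range p)
  have : FiniteDimensional K ZK := FiniteDimensional.span_of_finite K (Set.finite_range z)
  let D := derivationsOver (E : Set ℝ)
  let Q₁ := derivationsOver (Set.range p)
  let Q₂ := derivationsOver (Set.range fun i ↦ Real.exp (z i))
  let Q₃ := derivationsOver (ZK : Set ℝ)
  let Q₄ := derivationsOver (expGraph ↑(P ⊔ (Z ⊔ E.ratSubmodule)))
  have hle : Q₁ ⊓ (Q₂ ⊓ (Q₃ ⊓ Q₄)) ≤ derivationsOver (expGraph ↑(P ⊔ Z)) :=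
    inf_le_right.trans <| inf_le_right.trans <| inf_le_right.trans <| derivationsOver_anti <|
      expGraph_mono <| SetLike.coe_subset_coe.2 <| sup_le_sup_left le_sup_left _
  refine (Submodule.relLength_anti_right _ hle).trans ?_
  rw [Submodule.relLength_inf, Submodule.relLength_inf, Submodule.relLength_inf]
  have hK {δ : Derivation ℤ ℝ ℝ} (hδ : δ ∈ Q₁) : K ≤ δ.constants := Subfield.closure_le.2 hδ
  refine add_le_add ?_ (add_le_add ?_ (add_le_add ?_ ?_))
  · simpa using relLength_derivationsOver_range_le p D
  · refine relLength_derivationsOver_le_td (Set.finite_range _) ?_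
    rw [derivationsOver_union]
    exact inf_le_inf_right _ (derivationsOver_anti (subset_expClosure C))
  · refine relLength_derivationsOver_le_relLength_span ?_ ZK
    rintro δ ⟨⟨hD, h₁⟩, -⟩
    rw [derivationsOver_union]
    exact ⟨hK h₁, hD⟩
  · refine relLength_derivationsOver_expGraph_le ?_ ?_
    · rintro δ ⟨⟨⟨hD, h₁⟩, -⟩, h₃⟩
      have hZ : Z ≤ δ.constants.ratSubmodule :=
        Submodule.span_le.2 fun x hx ↦ h₃ x (Submodule.subset_span hx)
      exact sup_le (Submodule.span_le.2 h₁) (sup_le hZ hD)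
    · rintro δ ⟨⟨⟨hD, -⟩, h₂⟩, h₃⟩
      refine sup_le (Submodule.span_le.2 ?_) fun x hx ↦ ?_
      · rintro _ ⟨i, rfl⟩
        have h0 : δ (Real.exp (z i)) = 0 := h₂ _ ⟨i, rfl⟩
        rw [SetLike.mem_coe, mem_ker_expDefect, h0, h₃ _ (Submodule.subset_span ⟨i, rfl⟩), mul_zero]
      · rw [mem_ker_expDefect, hD x hx, hD _ (exp_mem_expClosure hx), mul_zero]

theorem Submodule.length_eq_relLength_add {K M : Type*} [DivisionRing K] [AddCommGroup M]
    [Module K M] (P Q : Submodule K M) :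
    Module.length K P = Module.length K ↑(P ⊓ Q) + P.relLength Q := by
  rw [← Submodule.relLength_bot, Submodule.relLength_add_of_le (Q := P ⊓ Q) bot_le inf_le_left,
    Submodule.relLength_bot, Submodule.relLength_inf_left]

theorem length_inf_le_length_span_inf {C : Set ℝ} {ι : Type*} {p : ι → ℝ}
    (hp : ∀ i, p i ∉ expClosure (C ∪ p '' {j | j ≠ i})) {z : Set ℝ} (hz : z.Finite) :
    Module.length ℚ ↑(Submodule.span ℚ z ⊓ (expClosure C).ratSubmodule) ≤
      Module.length (Subfield.closure (Set.range p))
        ↑(Submodule.span (Subfield.closure (Set.range p)) z ⊓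
          Submodule.span (Subfield.closure (Set.range p)) (expClosure C : Set ℝ)) := by
  set K := Subfield.closure (Set.range p)
  have : FiniteDimensional ℚ (Submodule.span ℚ z) := FiniteDimensional.span_of_finite ℚ hz
  have : FiniteDimensional K (Submodule.span K z) := FiniteDimensional.span_of_finite K hz
  have : FiniteDimensional ℚ ↑(Submodule.span ℚ z ⊓ (expClosure C).ratSubmodule) :=
    Submodule.finiteDimensional_inf_left _ _
  have : FiniteDimensional K ↑(Submodule.span K z ⊓ Submodule.span K (expClosure C : Set ℝ)) :=
    Submodule.finiteDimensional_inf_left _ _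
  let b := Module.finBasis ℚ ↑(Submodule.span ℚ z ⊓ (expClosure C).ratSubmodule)
  have hspan : Submodule.span ℚ z ≤ (Submodule.span K z).restrictScalars ℚ :=
    Submodule.span_le.2 Submodule.subset_span
  let x (i) : expClosure C := ⟨b i, (b i).2.2⟩
  have hx : LinearIndependent ℤ x := by
    have h := (b.linearIndependent.map' (Submodule.subtype _)
      (Submodule.ker_subtype _)).restrict_scalars' ℤ
    exact LinearIndependent.of_comp (expClosure C).subtype.toAddMonoidHom.toIntLinearMap h
  have hxK := (algebraicIndependent_of_notMem_expClosure hp).linearIndependent_subfield_closure hx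
  rw [Module.length_eq_finrank, Module.length_eq_finrank, Nat.cast_le]
  have hli : LinearIndependent K (fun i ↦ (⟨b i, hspan (b i).2.1,
      Submodule.subset_span (b i).2.2⟩ :
        ↑(Submodule.span K z ⊓ Submodule.span K (expClosure C : Set ℝ)))) :=
    LinearIndependent.of_comp (Submodule.subtype _) hxK
  simpa using hli.fintype_card_le_finrank

theorem ldim_empty {K F : Type*} [DivisionRing K] [AddCommGroup F] [Module K F] (X : Set F) :
    ldim K X ∅ = Module.finrank K (Submodule.span K X) := by
  rw [ldim, Set.union_empty]
  have : Function.Injective (Submodule.span K (∅ : Set F)).mkQ := by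
    rw [← LinearMap.ker_eq_bot, Submodule.ker_mkQ, Submodule.span_empty]
  exact (Submodule.equivMapOfInjective _ this _).finrank_eq.symm

/-- Theorem 1.3 for `F = ℝ` (where `ker exp = {0}`): if `C` is an ecl-closed subfield
of `ℝ` and `p₁,…,p_m` are exponentially algebraically independent over `C`, then for
every tuple `z`:
`td(exp z / C ∪ p) + ldim_{ℚ(p)}(z) − ldim_ℚ(z) ≥ 0`.
(The transcendence degree here is at most `n`, hence finite, so `Cardinal.toNat`
loses no information.) -/
theorem powers_schanuel_property (C : Subfield ℝ)
    (hC : ∀ x : ℝ, IsExpAlgebraicOver (C : Set ℝ) x → x ∈ C)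
    (m : ℕ) (p : Fin m → ℝ)
    (hp : ∀ i, ¬ IsExpAlgebraicOver ((C : Set ℝ) ∪ p '' {j | j ≠ i}) (p i))
    (n : ℕ) (z : Fin n → ℝ) :
    0 ≤ ((td (Set.range fun i => Real.exp (z i)) ((C : Set ℝ) ∪ Set.range p)).toNat : ℤ)
        + (ldim ↥(Subfield.closure (Set.range p)) (Set.range z) (∅ : Set ℝ) : ℤ)
        - (ldim ℚ (Set.range z) (∅ : Set ℝ) : ℤ) := by
  have hp' (i) : p i ∉ expClosure ((C : Set ℝ) ∪ p '' {j | j ≠ i}) :=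
    fun h ↦ hp i (isExpAlgebraicOver_of_mem_expClosure h)
  let K := Subfield.closure (Set.range p)
  let E := expClosure (C : Set ℝ)
  let P := Submodule.span ℚ (Set.range p)
  let Z := Submodule.span ℚ (Set.range z)
  let ZK := Submodule.span K (Set.range z)
  have : FiniteDimensional ℚ P := FiniteDimensional.span_of_finite ℚ (Set.finite_range p)
  have : FiniteDimensional ℚ Z := FiniteDimensional.span_of_finite ℚ (Set.finite_range z)
  have : FiniteDimensional K ZK := FiniteDimensional.span_of_finite K (Set.finite_range z)
  have hlower := relLength_expClosure_union_add_le (C : Set ℝ) p hp' (V := P ⊔ Z)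
    fun i ↦ Submodule.mem_sup_left (Submodule.subset_span ⟨i, rfl⟩)
  have hupper := relLength_expGraph_span_le (C : Set ℝ) p z
  have hinf := length_inf_le_length_span_inf hp' (Set.finite_range z)
  have hZ := Z.length_eq_relLength_add E.ratSubmodule
  have hZK := ZK.length_eq_relLength_add (Submodule.span K (E : Set ℝ))
  have hrel := Submodule.relLength_sup P Z E.ratSubmodule
  rw [Module.length_eq_finrank] at hZ hZK
  obtain ⟨a, -, ha, -⟩ := P.exists_basis_mod (Z ⊔ E.ratSubmodule)
  have key : Z.relLength E.ratSubmodule ≤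
      (td (Set.range fun i ↦ Real.exp (z i)) ((C : Set ℝ) ∪ Set.range p)).toNat +
        ZK.relLength (Submodule.span K (E : Set ℝ)) := by
    have h := hlower.trans hupper
    rw [hrel, ← ha] at h
    refine (ENat.add_le_add_iff_right (ENat.natCast_ne_top (a + m))).1 ?_
    push_cast
    refine le_of_eq_of_le (by ring) (h.trans_eq (by ring))
  have : (Module.finrank ℚ Z : ℕ∞) ≤
      (td (Set.range fun i ↦ Real.exp (z i)) ((C : Set ℝ) ∪ Set.range p)).toNat +
        Module.finrank K ZK := by
    rw [hZ, hZK, add_left_comm]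
    exact add_le_add hinf key
  rw [ldim_empty, ldim_empty, sub_nonneg]
  exact_mod_cast this
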